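/- arXiv:1406.2040 — 13 statements merged into one kernel-verified Lean document; each statement's English description precedes it below -/
import Mathlib

section
/- Define g : ℝ → ℝ by g(x) := arctan((tan x)²). Then for every φ ∈ (−π/2, π/2): (i) if |φ| < π/4 then g^{∘k}(φ) → 0 as k → ∞; (ii) if π/4 < |φ| < π/2 then g^{∘k}(φ) → π/2 as k → ∞; (iii) if |φ| = π/4 then g^{∘k}(φ) = π/4 for all k ≥ 1. (Square-wave limit of composed gearbox circuits.) -/
open Real Filter

/-- The angle transformation effected by a successful single-input gearbox circuit. -/
noncomputable def gearboxAngle : ℝ → ℝ := fun x => Real.arctan (Real.tan x ^ 2)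

theorem gearboxAngle_iterate {φ : ℝ} (hφ : φ ∈ Set.Ioo (-(π / 2)) (π / 2)) (k : ℕ) :
    gearboxAngle^[k] φ = arctan (tan φ ^ 2 ^ k) := by
  induction k with
  | zero => simp [arctan_tan hφ.1 hφ.2]
  | succ k ih =>
    rw [Function.iterate_succ_apply', ih]
    simp only [gearboxAngle, tan_arctan]
    rw [← pow_mul, ← pow_succ]

theorem abs_tan_eq_tan_abs {φ : ℝ} (hφ : φ ∈ Set.Ioo (-(π / 2)) (π / 2)) :
    |tan φ| = tan |φ| := by
  rcases le_total 0 φ with h | h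
  · rw [abs_of_nonneg h, abs_of_nonneg (tan_nonneg_of_nonneg_of_le_pi_div_two h hφ.2.le)]
  · rw [abs_of_nonpos h, tan_neg,
      abs_of_nonpos (tan_nonpos_of_nonpos_of_neg_pi_div_two_le h hφ.1.le)]

theorem even_two_pow_of_one_le {k : ℕ} (hk : 1 ≤ k) : Even (2 ^ k) :=
  Nat.even_pow.2 ⟨even_two, by omega⟩

/-- Square-wave limit of composed gearbox circuits: on `(-π/2, π/2)` the iterates of
`g(x) = arctan (tan² x)` tend to `0` for `|φ| < π/4`, to `π/2` for `π/4 < |φ| < π/2`,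
and are constantly `π/4` when `|φ| = π/4`. -/
theorem gearbox_square_wave_limit (φ : ℝ) (hφ : φ ∈ Set.Ioo (-(π / 2)) (π / 2)) :
    (|φ| < π / 4 → Tendsto (fun k => gearboxAngle^[k] φ) atTop (nhds 0)) ∧
    (π / 4 < |φ| → Tendsto (fun k => gearboxAngle^[k] φ) atTop (nhds (π / 2))) ∧
    (|φ| = π / 4 → ∀ k : ℕ, 1 ≤ k → gearboxAngle^[k] φ = π / 4) := by
  have habs : |φ| ∈ Set.Ioo (-(π / 2)) (π / 2) :=
    ⟨by linarith [abs_nonneg φ, pi_pos], abs_lt.2 hφ⟩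
  have hquarter : π / 4 ∈ Set.Ioo (-(π / 2)) (π / 2) := by
    constructor <;> linarith [pi_pos]
  have hpow : Tendsto (fun k : ℕ => 2 ^ k) atTop atTop :=
    tendsto_pow_atTop_atTop_of_one_lt one_lt_two
  simp only [gearboxAngle_iterate hφ]
  refine ⟨fun h => ?_, fun h => ?_, fun h k hk => ?_⟩
  · have ht : |tan φ| < 1 := by
      rw [abs_tan_eq_tan_abs hφ, ← tan_pi_div_four]
      exact strictMonoOn_tan habs hquarter h
    have hlim := (tendsto_pow_atTop_nhds_zero_of_abs_lt_one ht).comp hpow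
    simpa [Function.comp_def] using (continuous_arctan.tendsto 0).comp hlim
  · have ht : 1 < |tan φ| := by
      rw [abs_tan_eq_tan_abs hφ, ← tan_pi_div_four]
      exact strictMonoOn_tan hquarter habs h
    have hlim := (tendsto_pow_atTop_atTop_of_one_lt ht).comp hpow
    refine ((tendsto_arctan_atTop.mono_right nhdsWithin_le_nhds).comp hlim).congr' ?_
    filter_upwards [eventually_ge_atTop 1] with k hk
    simp only [Function.comp_apply, (even_two_pow_of_one_le hk).pow_abs]
  · rw [← (even_two_pow_of_one_le hk).pow_abs, abs_tan_eq_tan_abs hφ, h, tan_pi_div_four,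
      one_pow, arctan_one]
end

section
/- Define G : ℝ → ℝ by G(x) := arctan(tan²(arcsin|sin x|)). Then for all nonnegative integers m ≠ n, ∫₀^π (G(2^m x) − π/4)(G(2^n x) − π/4) dx = 0. (Orthogonality property of dilated gearbox functions.) -/
open Real

/-- The single-input gearbox angle function, extended to all of `ℝ` via `arcsin |sin x|`. -/
noncomputable def gearboxFun (x : ℝ) : ℝ :=
  Real.arctan (Real.tan (Real.arcsin |Real.sin x|) ^ 2)

theorem gearboxFun_eq_arctan_tan_sq (x : ℝ) : gearboxFun x = Real.arctan (Real.tan x ^ 2) := by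
  unfold gearboxFun
  have h : 1 - Real.sin x ^ 2 = Real.cos x ^ 2 := by linarith [Real.sin_sq_add_cos_sq x]
  rw [Real.tan_arcsin, div_pow, sq_abs, h, Real.sq_sqrt (sq_nonneg _), Real.tan_eq_sin_div_cos,
    div_pow]

theorem gearboxFun_periodic : Function.Periodic gearboxFun π := fun x => by
  rw [gearboxFun_eq_arctan_tan_sq, gearboxFun_eq_arctan_tan_sq, Real.tan_periodic x]

/-- Half-wave antisymmetry, valid off the zeros of `sin` and `cos`. -/
theorem gearboxFun_add_pi_div_two {x : ℝ} (hx : Real.tan x ≠ 0) :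
    gearboxFun (x + π / 2) - π / 4 = -(gearboxFun x - π / 4) := by
  have h : Real.tan (x + π / 2) ^ 2 = (Real.tan x ^ 2)⁻¹ := by
    simp [Real.tan_eq_sin_div_cos, Real.sin_add_pi_div_two, Real.cos_add_pi_div_two, div_pow]
  rw [gearboxFun_eq_arctan_tan_sq, gearboxFun_eq_arctan_tan_sq, h,
    Real.arctan_inv_of_pos (by positivity)]
  ring

theorem ae_tan_mul_ne_zero {c : ℝ} (hc : c ≠ 0) :
    ∀ᵐ x : ℝ, Real.tan (c * x) ≠ 0 := by
  have hs : (Set.range fun k : ℤ => (k : ℝ) * π / 2 / c).Countable := Set.countable_range _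
  filter_upwards [hs.ae_notMem MeasureTheory.volume] with x hx h
  obtain ⟨k, hk⟩ := Real.tan_eq_zero_iff.mp h
  exact hx ⟨k, by simp only [hk]; field_simp⟩

theorem gearbox_orthogonality_of_lt {m n : ℕ} (hmn : m < n) :
    ∫ x in (0:ℝ)..π, (gearboxFun (2 ^ m * x) - π / 4) * (gearboxFun (2 ^ n * x) - π / 4) = 0 := by
  set F : ℝ → ℝ := fun x =>
    (gearboxFun (2 ^ m * x) - π / 4) * (gearboxFun (2 ^ n * x) - π / 4) with hF
  have hdil (k : ℕ) (x : ℝ) : gearboxFun (x + 2 ^ k * π) = gearboxFun x := by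
    simpa using gearboxFun_periodic.nat_mul (2 ^ k) x
  have hper : Function.Periodic F π := fun x => by simp only [hF, mul_add, hdil]
  set h : ℝ := π / 2 / 2 ^ m with hh
  have hshift : ∀ᵐ x : ℝ, F (x + h) = -F x := by
    filter_upwards [ae_tan_mul_ne_zero (c := 2 ^ m) (by positivity)] with x hx
    obtain ⟨k, rfl⟩ := Nat.exists_eq_add_of_lt hmn
    have h1 : (2:ℝ) ^ m * (x + h) = 2 ^ m * x + π / 2 := by rw [hh]; field_simp
    have h2 : (2:ℝ) ^ (m + k + 1) * (x + h) = 2 ^ (m + k + 1) * x + 2 ^ k * π := by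
      rw [hh, pow_succ, pow_add]; field_simp
    simp only [hF, h1, h2, hdil, gearboxFun_add_pi_div_two hx, neg_mul]
  have key : ∫ x in (0:ℝ)..π, F x = -∫ x in (0:ℝ)..π, F x :=
    calc ∫ x in (0:ℝ)..π, F x = ∫ x in h..h + π, F x := by
          simpa using hper.intervalIntegral_add_eq 0 h
      _ = ∫ x in (0:ℝ)..π, F (x + h) := by
          rw [intervalIntegral.integral_comp_add_right, zero_add, add_comm]
      _ = ∫ x in (0:ℝ)..π, -F x :=
          intervalIntegral.integral_congr_ae (hshift.mono fun x hx _ => hx)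
      _ = -∫ x in (0:ℝ)..π, F x := intervalIntegral.integral_neg
  linarith

/-- Orthogonality property of dilated gearbox functions: for distinct nonnegative
integers `m ≠ n`, `∫₀^π (G(2^m x) − π/4)(G(2^n x) − π/4) dx = 0`. -/
theorem gearbox_orthogonality (m n : ℕ) (hmn : m ≠ n) :
    ∫ x in (0:ℝ)..π, (gearboxFun (2 ^ m * x) - π / 4) * (gearboxFun (2 ^ n * x) - π / 4) = 0 := by
  rcases hmn.lt_or_gt with h | h
  · exact gearbox_orthogonality_of_lt h
  · simpa only [mul_comm (gearboxFun (2 ^ n * _) - π / 4)] using gearbox_orthogonality_of_lt h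
end

section
/- Fix an integer k ≥ 1. There exist constants C > 0 and δ > 0 such that for all φ₁,…,φ_k ∈ ℝ with max_j |φ_j| ≤ δ, |arctan(∏_{j=1}^k tan φ_j) − ∏_{j=1}^k φ_j| ≤ C · (max_j |φ_j|)^{k+2}. (Non-linearity property of the generalized PAR angle function.) -/
open Real BigOperators

theorem abs_tan_sub_self_le {x : ℝ} (hx : |x| ≤ 1) : |tan x - x| ≤ |x| ^ 3 := by
  have nonneg_case : ∀ y : ℝ, 0 ≤ y → y ≤ 1 → |tan y - y| ≤ y ^ 3 := by
    intro y hy hy1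
    have hlt : y < π / 2 := by linarith [pi_gt_three]
    rw [abs_of_nonneg (sub_nonneg.2 (le_tan hy hlt)), sub_le_iff_le_add]
    have hcos : 1 - y ^ 2 / 2 ≤ cos y := one_sub_sq_div_two_le_cos
    have hpos : 0 < cos y := by nlinarith
    rw [tan_eq_sin_div_cos, div_le_iff₀ hpos]
    have hmul : (y ^ 3 + y) * (1 - y ^ 2 / 2) ≤ (y ^ 3 + y) * cos y := by gcongr
    have hy3 : 0 ≤ y ^ 3 * (1 - y ^ 2) := mul_nonneg (by positivity) (by nlinarith)
    nlinarith [sin_le hy]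
  rcases le_total 0 x with h | h
  · rw [abs_of_nonneg h] at hx ⊢
    exact nonneg_case x h hx
  · rw [abs_of_nonpos h] at hx ⊢
    have := nonneg_case (-x) (by linarith) hx
    rwa [tan_neg, ← neg_sub', abs_neg] at this

theorem abs_arctan_sub_self_le (t : ℝ) : |arctan t - t| ≤ |t| ^ 3 := by
  have nonneg_case : ∀ s : ℝ, 0 ≤ s → |arctan s - s| ≤ s ^ 3 := by
    intro s hs
    have h0 : 0 ≤ arctan s := arctan_nonneg.2 hs
    have hle : arctan s ≤ s := by
      simpa using le_tan h0 (arctan_lt_pi_div_two s)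
    rcases le_total (arctan s) 1 with h | h
    · have := abs_tan_sub_self_le (x := arctan s) (by rwa [abs_of_nonneg h0])
      rw [tan_arctan, abs_sub_comm, abs_of_nonneg h0] at this
      exact this.trans (by gcongr)
    · rw [abs_of_nonpos (by linarith)]
      have : s ≤ s ^ 3 := le_self_pow₀ (h.trans hle) (by norm_num)
      linarith
  rcases le_total 0 t with h | h
  · rw [abs_of_nonneg h]
    exact nonneg_case t h
  · rw [abs_of_nonpos h]
    have := nonneg_case (-t) (by linarith)
    rwa [arctan_neg, ← neg_sub', abs_neg] at this

theorem abs_prod_le_pow_card {ι : Type*} (s : Finset ι) {a : ι → ℝ} {m : ℝ}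
    (ha : ∀ i, |a i| ≤ m) : |∏ i ∈ s, a i| ≤ m ^ s.card := by
  rw [Finset.abs_prod, ← Finset.prod_const]
  exact Finset.prod_le_prod (fun i _ => abs_nonneg (a i)) fun i _ => ha i

theorem abs_prod_sub_prod_le {ι : Type*} (s : Finset ι) {a b : ι → ℝ} {m : ℝ} (hm : 0 ≤ m)
    (ha : ∀ i, |a i| ≤ 2 * m) (hb : ∀ i, |b i| ≤ m) (hab : ∀ i, |a i - b i| ≤ m ^ 3) :
    |∏ i ∈ s, a i - ∏ i ∈ s, b i| ≤ 4 ^ s.card * m ^ (s.card + 2) := by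
  classical
  induction s using Finset.induction_on with
  | empty => simpa using sq_nonneg m
  | insert i s hi ih =>
    rw [Finset.prod_insert hi, Finset.prod_insert hi, Finset.card_insert_of_notMem hi]
    calc |a i * ∏ j ∈ s, a j - b i * ∏ j ∈ s, b j|
        = |(a i - b i) * ∏ j ∈ s, a j + b i * (∏ j ∈ s, a j - ∏ j ∈ s, b j)| := by ring_nf
      _ ≤ |a i - b i| * |∏ j ∈ s, a j| + |b i| * |∏ j ∈ s, a j - ∏ j ∈ s, b j| := by
        rw [← abs_mul, ← abs_mul]
        exact abs_add_le _ _
      _ ≤ m ^ 3 * (2 * m) ^ s.card + m * (4 ^ s.card * m ^ (s.card + 2)) := by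
        gcongr
        · exact hab i
        · exact abs_prod_le_pow_card s ha
        · exact hb i
      _ = (2 ^ s.card + 4 ^ s.card) * m ^ (s.card + 1 + 2) := by ring
      _ ≤ 4 ^ (s.card + 1) * m ^ (s.card + 1 + 2) := by
        gcongr
        have h : (2 : ℝ) ^ s.card ≤ 4 ^ s.card := by gcongr; norm_num
        have h4 : (0 : ℝ) ≤ 4 ^ s.card := by positivity
        rw [pow_succ]
        linarith

/-- Non-linearity property of the generalized PAR angle function:
`arctan (∏ tan φⱼ) = ∏ φⱼ + O((max |φⱼ|)^(k+2))` as the inputs tend to zero. -/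
theorem par_nonlinearity (k : ℕ) (hk : 1 ≤ k) :
    ∃ C > (0:ℝ), ∃ δ > (0:ℝ), ∀ φ : Fin k → ℝ,
      (⨆ j, |φ j|) ≤ δ →
      |Real.arctan (∏ j, Real.tan (φ j)) - ∏ j, φ j| ≤ C * (⨆ j, |φ j|) ^ (k + 2) := by
  refine ⟨8 ^ k + 4 ^ k, by positivity, 1, one_pos, fun φ hφ => ?_⟩
  have hb : ∀ j, |φ j| ≤ ⨆ j, |φ j| := le_ciSup (Set.finite_range fun j => |φ j|).bddAbove
  set m := ⨆ j, |φ j|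
  have hm : 0 ≤ m := (abs_nonneg _).trans (hb ⟨0, hk⟩)
  have hab : ∀ j, |tan (φ j) - φ j| ≤ m ^ 3 := fun j =>
    (abs_tan_sub_self_le ((hb j).trans hφ)).trans (by gcongr; exact hb j)
  have ha : ∀ j, |tan (φ j)| ≤ 2 * m := fun j => by
    have h3 : m ^ 3 ≤ m := pow_le_of_le_one hm hφ (by norm_num)
    linarith [abs_sub_abs_le_abs_sub (tan (φ j)) (φ j), hab j, hb j]
  have hprod := abs_prod_sub_prod_le Finset.univ hm ha hb hab
  have htan := abs_prod_le_pow_card Finset.univ ha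
  rw [Finset.card_fin] at hprod htan
  have harctan : |arctan (∏ j, tan (φ j)) - ∏ j, tan (φ j)| ≤ 8 ^ k * m ^ (k + 2) :=
    calc _ ≤ |∏ j, tan (φ j)| ^ 3 := abs_arctan_sub_self_le _
      _ ≤ ((2 * m) ^ k) ^ 3 := by gcongr
      _ = 8 ^ k * m ^ (3 * k) := by
        rw [← pow_mul, mul_comm k 3, mul_pow, pow_mul 2]
        norm_num
      _ ≤ 8 ^ k * m ^ (k + 2) :=
        mul_le_mul_of_nonneg_left (pow_le_pow_of_le_one hm hφ (by omega)) (by positivity)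
  rw [add_mul]
  exact (abs_sub_le _ _ _).trans (add_le_add harctan hprod)
end

section
/- Fix an integer k ≥ 1. There exist constants C > 0 and δ > 0 such that for all φ₁,…,φ_k ∈ ℝ with max_j |φ_j| ≤ δ, |arctan(tan²(arcsin(∏_{j=1}^k |sin φ_j|))) − ∏_{j=1}^k φ_j²| ≤ C · (max_j |φ_j|)^{2k+2}. (Non-linearity property of the gearbox angle function.) -/
open Real BigOperators

lemma sq_mul_one_sub_sq_le_sin_sq {x : ℝ} (hx : |x| ≤ 1) :
    x ^ 2 * (1 - x ^ 2) ≤ Real.sin x ^ 2 := by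
  rcases (abs_nonneg x).eq_or_lt with h | h
  · simp [abs_eq_zero.mp h.symm]
  · have h1 := Real.sin_gt_sub_cube h
    have h2 : Real.sin |x| ^ 2 = Real.sin x ^ 2 := by
      rcases abs_choice x with h | h <;> simp [h]
    have h3 : |x| ^ 2 ≤ 1 := by nlinarith
    have h4 : 0 ≤ |x| - |x| ^ 3 / 6 := by nlinarith
    have h5 := pow_le_pow_left₀ h4 h1.le 2
    rw [← h2, ← sq_abs x]
    refine le_trans ?_ h5
    nlinarith [sq_nonneg (|x| ^ 2), sq_nonneg (|x| ^ 3)]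

lemma prod_mul_one_sub_sum_le_prod {ι : Type*} (s : Finset ι) {a b c : ι → ℝ}
    (ha : ∀ i, 0 ≤ a i) (hb : ∀ i, 0 ≤ b i) (hab : ∀ i, a i ≤ b i) (hc : ∀ i, 0 ≤ c i)
    (h : ∀ i, b i * (1 - c i) ≤ a i) :
    (∏ i ∈ s, b i) * (1 - ∑ i ∈ s, c i) ≤ ∏ i ∈ s, a i := by
  classical
  induction s using Finset.induction_on with
  | empty => simp
  | insert i s hi ih =>
    rw [Finset.prod_insert hi, Finset.prod_insert hi, Finset.sum_insert hi]
    have hA : ∏ j ∈ s, a j ≤ ∏ j ∈ s, b j :=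
      Finset.prod_le_prod (fun j _ => ha j) (fun j _ => hab j)
    calc b i * (∏ j ∈ s, b j) * (1 - (c i + ∑ j ∈ s, c j))
        = b i * ((∏ j ∈ s, b j) * (1 - ∑ j ∈ s, c j)) - b i * c i * ∏ j ∈ s, b j := by ring
      _ ≤ b i * (∏ j ∈ s, a j) - b i * c i * ∏ j ∈ s, a j :=
          sub_le_sub (mul_le_mul_of_nonneg_left ih (hb i))
            (mul_le_mul_of_nonneg_left hA (mul_nonneg (hb i) (hc i)))
      _ = b i * (1 - c i) * ∏ j ∈ s, a j := by ring
      _ ≤ a i * ∏ j ∈ s, a j :=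
          mul_le_mul_of_nonneg_right (h i) (Finset.prod_nonneg fun j _ => ha j)

lemma arctan_tan_arcsin_sq_bounds {s : ℝ} (h0 : 0 ≤ s) (h1 : s ≤ 1 / 2) :
    s ^ 2 ≤ Real.arctan (Real.tan (Real.arcsin s) ^ 2) ∧
      Real.arctan (Real.tan (Real.arcsin s) ^ 2) ≤ s ^ 2 + 2 * s ^ 4 := by
  have hs : 0 < 1 - s ^ 2 := by nlinarith
  have ht : Real.tan (Real.arcsin s) ^ 2 = s ^ 2 / (1 - s ^ 2) := by
    rw [Real.tan_arcsin, div_pow, Real.sq_sqrt hs.le]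
  rw [ht]
  set t := s ^ 2 / (1 - s ^ 2) with ht_def
  have ht0 : 0 ≤ t := by positivity
  have hy0 : 0 ≤ Real.arctan t := Real.arctan_nonneg.mpr ht0
  constructor
  · have hst : s ^ 2 = t / (1 + t) := by
      rw [ht_def]
      field_simp
      ring
    calc s ^ 2 = t / (1 + t) := hst
      _ ≤ t / √(1 + t ^ 2) := by
          apply div_le_div_of_nonneg_left ht0 (by positivity)
          rw [Real.sqrt_le_left (by positivity)]
          nlinarith
      _ = Real.sin (Real.arctan t) := (Real.sin_arctan t).symm
      _ ≤ Real.arctan t := Real.sin_le hy0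
  · calc Real.arctan t ≤ Real.tan (Real.arctan t) :=
          Real.le_tan hy0 (Real.arctan_lt_pi_div_two t)
      _ = t := Real.tan_arctan t
      _ ≤ s ^ 2 + 2 * s ^ 4 := by
          rw [ht_def, div_le_iff₀ hs]
          have : s ^ 2 ≤ 1 / 2 := by nlinarith
          nlinarith [mul_nonneg (pow_nonneg h0 4) (sub_nonneg.mpr this)]

/-- Non-linearity property of the gearbox angle function:
`arctan (tan² (arcsin (∏ |sin φⱼ|))) = ∏ φⱼ² + O((max |φⱼ|)^(2k+2))`
as the inputs tend to zero. -/
theorem gearbox_nonlinearity (k : ℕ) (hk : 1 ≤ k) :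
    ∃ C > (0:ℝ), ∃ δ > (0:ℝ), ∀ φ : Fin k → ℝ,
      (⨆ j, |φ j|) ≤ δ →
      |Real.arctan (Real.tan (Real.arcsin (∏ j, |Real.sin (φ j)|)) ^ 2) - ∏ j, (φ j) ^ 2|
        ≤ C * (⨆ j, |φ j|) ^ (2 * k + 2) := by
  refine ⟨k + 2, by positivity, 1 / 2, by norm_num, fun φ hφ => ?_⟩
  set m := ⨆ j, |φ j|
  have hm : ∀ j, |φ j| ≤ m := fun j => le_ciSup (Set.finite_range fun j => |φ j|).bddAbove j
  have hm0 : 0 ≤ m := Real.iSup_nonneg fun j => abs_nonneg (φ j)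
  set s := ∏ j, |Real.sin (φ j)|
  have hs0 : 0 ≤ s := Finset.prod_nonneg fun j _ => abs_nonneg _
  have hsm : s ≤ m ^ k := by
    simpa using Finset.prod_le_prod (s := Finset.univ) (g := fun _ : Fin k => m)
      (fun j _ => abs_nonneg (Real.sin (φ j))) fun j _ => Real.abs_sin_le_abs.trans (hm j)
  have hs1 : s ≤ 1 / 2 :=
    hsm.trans ((pow_le_of_le_one hm0 (by linarith) (by omega)).trans hφ)
  have hs4 : s ^ 4 ≤ m ^ (2 * k + 2) :=
    calc s ^ 4 ≤ (m ^ k) ^ 4 := pow_le_pow_left₀ hs0 hsm 4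
      _ = m ^ (k * 4) := (pow_mul m k 4).symm
      _ ≤ m ^ (2 * k + 2) := pow_le_pow_of_le_one hm0 (by linarith) (by omega)
  have hs2 : s ^ 2 = ∏ j, Real.sin (φ j) ^ 2 := by
    simp only [s, ← Finset.prod_pow, sq_abs]
  have hle : s ^ 2 ≤ ∏ j, φ j ^ 2 := by
    rw [hs2]
    exact Finset.prod_le_prod (fun j _ => sq_nonneg _)
      fun j _ => Real.sin_sq_le_sq
  have hsq : ∀ j, φ j ^ 2 ≤ m ^ 2 := fun j => sq_le_sq' (abs_le.mp (hm j)).1 (abs_le.mp (hm j)).2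
  have hge : (∏ j, φ j ^ 2) * (1 - ∑ j, φ j ^ 2) ≤ s ^ 2 := by
    rw [hs2]
    exact prod_mul_one_sub_sum_le_prod Finset.univ (fun j => sq_nonneg _) (fun j => sq_nonneg _)
      (fun j => Real.sin_sq_le_sq) (fun j => sq_nonneg _)
      fun j => sq_mul_one_sub_sq_le_sin_sq ((hm j).trans (by linarith))
  have hprod : ∏ j, φ j ^ 2 ≤ (m ^ 2) ^ k := by
    simpa using Finset.prod_le_prod (s := Finset.univ) (g := fun _ : Fin k => m ^ 2)
      (fun j _ => sq_nonneg (φ j)) fun j _ => hsq j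
  have hsum : ∑ j, φ j ^ 2 ≤ k * m ^ 2 := by
    simpa using Finset.sum_le_card_nsmul Finset.univ (fun j => φ j ^ 2) (m ^ 2) fun j _ => hsq j
  have hmul : (∏ j, φ j ^ 2) * ∑ j, φ j ^ 2 ≤ k * m ^ (2 * k + 2) :=
    calc (∏ j, φ j ^ 2) * ∑ j, φ j ^ 2 ≤ (m ^ 2) ^ k * (k * m ^ 2) :=
          mul_le_mul hprod hsum (Finset.sum_nonneg fun j _ => sq_nonneg _) (by positivity)
      _ = k * m ^ (2 * k + 2) := by ring
  obtain ⟨hlow, hupp⟩ := arctan_tan_arcsin_sq_bounds hs0 hs1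
  have hpow : 0 ≤ m ^ (2 * k + 2) := by positivity
  have hkpow : 0 ≤ k * m ^ (2 * k + 2) := by positivity
  rw [abs_le]
  constructor <;> linarith
end

section
/- Let a ∈ (0,1], let k ≥ 1 be an integer, set b := 2k, and let U ⊂ ℝ be a compact set. For every ε > 0 there exists a positive integer r such that for all x ∈ U, |r^b · arctan(tan²(arcsin(√a · |sin(x/r)|^k))) − a x^b| ≤ ε. (Time-slicing lemma, even-degree case: the monomial a x^b can be implemented to arbitrary accuracy by summing r^b identical gearbox rotations with rescaled inputs.) -/
open Real

lemma tan_arcsin_sq {y : ℝ} (hy : y ^ 2 ≤ 1) :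
    tan (arcsin y) ^ 2 = y ^ 2 / (1 - y ^ 2) := by
  rw [tan_arcsin, div_pow, sq_sqrt (by linarith)]

lemma hasDerivAt_arctan_div_one_sub :
    HasDerivAt (fun s : ℝ => arctan (s / (1 - s))) 1 0 := by
  have h := (((hasDerivAt_id (0 : ℝ)).div ((hasDerivAt_id (0 : ℝ)).const_sub 1)
    (by simp)).arctan)
  simpa using h

/-- The gearbox rotation is `a t ^ (2 * k)` up to a factor tending to `1` as `t → 0`. -/
lemma exists_gearbox_factor {a : ℝ} (ha : 0 ≤ a) (ha1 : a ≤ 1) {k : ℕ} (hk : k ≠ 0) :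
    ∃ h : ℝ → ℝ, ContinuousAt h 0 ∧ h 0 = 1 ∧ ∀ t,
      arctan (tan (arcsin (√a * |sin t| ^ k)) ^ 2) = a * t ^ (2 * k) * h t := by
  set g : ℝ → ℝ := fun s => arctan (s / (1 - s)) with hg
  refine ⟨fun t => sinc t ^ (2 * k) * dslope g 0 (a * sin t ^ (2 * k)), ?_, ?_, fun t => ?_⟩
  · have hd : ContinuousAt (dslope g 0) (a * sin 0 ^ (2 * k)) := by
      simpa [hk] using
        continuousAt_dslope_same.2 hasDerivAt_arctan_div_one_sub.differentiableAt
    have hs : ContinuousAt (fun t : ℝ => a * sin t ^ (2 * k)) 0 := by fun_prop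
    exact (continuous_sinc.continuousAt.pow _).mul
      (ContinuousAt.comp (f := fun t : ℝ => a * sin t ^ (2 * k)) hd hs)
  · simp [hk, dslope_same, hg, hasDerivAt_arctan_div_one_sub.deriv]
  · have hy : (√a * |sin t| ^ k) ^ 2 = a * sin t ^ (2 * k) := by
      rw [mul_pow, sq_sqrt ha, ← pow_mul, mul_comm k 2, pow_mul, sq_abs, ← pow_mul]
    have hsin : sin t ^ (2 * k) ≤ 1 := by
      rw [pow_mul]
      exact pow_le_one₀ (sq_nonneg _) (sin_sq_le_one t)
    have hle : a * sin t ^ (2 * k) ≤ 1 :=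
      mul_le_one₀ ha1 (by rw [pow_mul]; positivity) hsin
    have htsinc : t * sinc t = sin t := by
      by_cases ht : t = 0
      · simp [ht]
      · rw [sinc_of_ne_zero ht, mul_div_cancel₀ _ ht]
    have hslope := sub_smul_dslope g 0 (a * sin t ^ (2 * k))
    rw [tan_arcsin_sq (by rw [hy]; exact hle), hy]
    simp only [hg, sub_zero, smul_eq_mul, zero_div, arctan_zero] at hslope ⊢
    rw [← hslope]
    nth_rewrite 1 [← htsinc]
    ring

/-- Time-slicing lemma, even-degree case: for `a ∈ (0,1]`, `b = 2k`, and a compact set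
`U ⊂ ℝ`, the monomial `a x^b` can be implemented to arbitrary accuracy by summing `r^b`
identical gearbox rotations `GB(arcsin √a, x/r, …, x/r)` with rescaled inputs. -/
theorem time_slicing_even (a : ℝ) (ha : 0 < a) (ha1 : a ≤ 1) (k : ℕ) (hk : 1 ≤ k)
    (U : Set ℝ) (hU : IsCompact U) (ε : ℝ) (hε : 0 < ε) :
    ∃ r : ℕ, 0 < r ∧ ∀ x ∈ U,
      |(r : ℝ) ^ (2 * k) *
          Real.arctan (Real.tan (Real.arcsin (Real.sqrt a * |Real.sin (x / r)| ^ k)) ^ 2)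
        - a * x ^ (2 * k)| ≤ ε := by
  obtain ⟨h, hcont, h0, hfac⟩ := exists_gearbox_factor ha.le ha1 (Nat.one_le_iff_ne_zero.1 hk)
  obtain ⟨M, hM, hUM⟩ := hU.isBounded.exists_pos_norm_le
  have hC : 0 < a * M ^ (2 * k) := by positivity
  obtain ⟨δ, hδ, hclose⟩ := Metric.continuousAt_iff.1 hcont _ (div_pos hε hC)
  obtain ⟨r, hr⟩ := exists_nat_gt (M / δ)
  have hr0 : (0 : ℝ) < r := (div_pos hM hδ).trans hr
  refine ⟨r, by exact_mod_cast hr0, fun x hx => ?_⟩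
  have hxM : |x| ≤ M := hUM x hx
  have hxr : dist (x / r) 0 < δ := by
    rw [dist_zero_right, norm_div, norm_eq_abs, norm_natCast, div_lt_iff₀ hr0]
    rw [div_lt_iff₀ hδ] at hr
    linarith
  have hh := (hclose hxr).le
  rw [h0, Real.dist_eq] at hh
  have hEq : (r : ℝ) ^ (2 * k) * (a * (x / r) ^ (2 * k) * h (x / r)) - a * x ^ (2 * k) =
      a * x ^ (2 * k) * (h (x / r) - 1) := by
    rw [div_pow]
    field_simp
  rw [hfac, hEq, abs_mul, abs_mul, abs_of_pos ha, abs_pow]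
  calc a * |x| ^ (2 * k) * |h (x / r) - 1|
      ≤ a * M ^ (2 * k) * (ε / (a * M ^ (2 * k))) := by gcongr
    _ = ε := mul_div_cancel₀ _ hC.ne'
end

section
/- Let 𝔉 be the smallest set of functions ℝ → ℝ containing all constant functions and all linear functions x ↦ c·x (c ∈ ℝ), and closed under: pointwise addition (f,g) ↦ f + g; PAR-combination (f,g) ↦ (x ↦ arctan(tan(f(x)) · tan(g(x)))); and GB-combination (f,g) ↦ (x ↦ arctan(tan²(arcsin(|sin(f(x))| · |sin(g(x))|)))). Then for every compact set U ⊂ ℝ, every function h that is real-analytic on an open set containing U, and every ε > 0, there exists g ∈ 𝔉 with |h(x) − g(x)| ≤ ε for all x ∈ U. (Theorem 3: any analytic function on a compact domain can be implemented to arbitrary accuracy using PAR, GB and addition.) -/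
open Real

/-- The smallest set of functions `ℝ → ℝ` containing all constants and all linear
functions `x ↦ c·x`, and closed under pointwise addition, PAR-combination and
GB-combination. -/
inductive RUSFun : (ℝ → ℝ) → Prop
  | const (c : ℝ) : RUSFun fun _ => c
  | linear (c : ℝ) : RUSFun fun x => c * x
  | add {f g : ℝ → ℝ} : RUSFun f → RUSFun g → RUSFun (f + g)
  | par {f g : ℝ → ℝ} : RUSFun f → RUSFun g →
      RUSFun fun x => Real.arctan (Real.tan (f x) * Real.tan (g x))
  | gb {f g : ℝ → ℝ} : RUSFun f → RUSFun g →
      RUSFun fun x =>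
        Real.arctan (Real.tan (Real.arcsin (|Real.sin (f x)| * |Real.sin (g x)|)) ^ 2)

namespace RUSFun

/-- Continuous functions on `U` whose arctangent is exactly implemented by a member of `RUSFun`. -/
def tanSet (U : Set ℝ) : Set C(U, ℝ) :=
  {t | ∃ g : ℝ → ℝ, RUSFun g ∧ ∀ x : U, g x = arctan (t x)}

variable {U : Set ℝ}

lemma nsmul {g : ℝ → ℝ} (hg : RUSFun g) (n : ℕ) : RUSFun fun x => n * g x := by
  induction n with
  | zero => simpa using RUSFun.const 0
  | succ n ih =>
    convert ih.add hg using 1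
    ext x
    simp only [Nat.cast_succ, Pi.add_apply]
    ring

lemma const_mem_tanSet (c : ℝ) : ContinuousMap.const U c ∈ tanSet U :=
  ⟨_, RUSFun.const (arctan c), fun _ => rfl⟩

lemma mul_mem_tanSet {s t : C(U, ℝ)} (hs : s ∈ tanSet U) (ht : t ∈ tanSet U) :
    s * t ∈ tanSet U := by
  obtain ⟨f, hf, hfs⟩ := hs
  obtain ⟨g, hg, hgt⟩ := ht
  exact ⟨_, hf.par hg, fun x => by simp [hfs, hgt, tan_arctan]⟩

lemma smul_mem_tanSet (c : ℝ) {t : C(U, ℝ)} (ht : t ∈ tanSet U) : c • t ∈ tanSet U := by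
  convert mul_mem_tanSet (const_mem_tanSet c) ht using 1
  ext x
  simp

variable [CompactSpace U]

lemma add_mem_closure_tanSet {s t : C(U, ℝ)} (hs : s ∈ tanSet U) (ht : t ∈ tanSet U) :
    s + t ∈ closure (tanSet U) := by
  rw [Metric.mem_closure_iff]
  intro ε hε
  set M : ℝ := ‖s‖ + ‖t‖
  have hM0 : 0 ≤ M := by positivity
  have hsM (x : U) : |s x| ≤ M :=
    (s.norm_coe_le_norm x).trans (le_add_of_nonneg_right (norm_nonneg t))
  have htM (x : U) : |t x| ≤ M :=
    (t.norm_coe_le_norm x).trans (le_add_of_nonneg_left (norm_nonneg s))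
  obtain ⟨r, hr, hr2, hr4⟩ : ∃ r : ℝ, 0 < r ∧ r * M ^ 2 ≤ 1 / 2 ∧ 4 * M ^ 3 * r < ε := by
    have h1 : ∀ᶠ r in nhdsWithin (0 : ℝ) (Set.Ioi 0), r * M ^ 2 < 1 / 2 :=
      nhdsWithin_le_nhds <|
        ContinuousAt.eventually_lt (by fun_prop) continuousAt_const (by norm_num)
    have h2 : ∀ᶠ r in nhdsWithin (0 : ℝ) (Set.Ioi 0), 4 * M ^ 3 * r < ε :=
      nhdsWithin_le_nhds <|
        ContinuousAt.eventually_lt (by fun_prop) continuousAt_const (by simpa)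
    obtain ⟨r, ⟨hr1, hr2⟩, hr⟩ := ((h1.and h2).and self_mem_nhdsWithin).exists
    exact ⟨r, hr, hr1.le, hr2⟩
  have hq (x : U) : |r * (s x * t x)| ≤ r * M ^ 2 := by
    rw [abs_mul, abs_of_pos hr, abs_mul, sq]
    gcongr
    exacts [hsM x, htM x]
  have hq' (x : U) : 1 / 2 ≤ 1 - r * (s x * t x) := by
    linarith [le_abs_self (r * (s x * t x)), hq x]
  set a := √r
  have ha : 0 < a := sqrt_pos.2 hr
  have haa : a * a = r := mul_self_sqrt hr.le
  obtain ⟨f, hf, hfs⟩ := smul_mem_tanSet a hs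
  obtain ⟨g, hg, hgt⟩ := smul_mem_tanSet a ht
  let w : C(U, ℝ) := ⟨fun x => (a * s x + a * t x) / (1 - a * s x * (a * t x)), by
    refine Continuous.div (by fun_prop) (by fun_prop) fun x => ?_
    have := hq' x
    rw [← haa] at this
    nlinarith⟩
  have hw : w ∈ tanSet U := by
    refine ⟨f + g, hf.add hg, fun x => ?_⟩
    have h1 : a * s x * (a * t x) < 1 := by
      have := hq' x
      rw [← haa] at this
      nlinarith
    simp [w, hfs, hgt, arctan_add h1]
  refine ⟨a⁻¹ • w, smul_mem_tanSet _ hw, ?_⟩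
  rw [ContinuousMap.dist_lt_iff hε]
  intro x
  have hx := hq' x
  have hd : 0 < 1 - r * (s x * t x) := by linarith
  have key : (s + t) x - (a⁻¹ • w) x
      = -((s x + t x) * (r * (s x * t x))) / (1 - r * (s x * t x)) := by
    have e : a * s x * (a * t x) = r * (s x * t x) := by rw [← haa]; ring
    simp only [w, ContinuousMap.add_apply, ContinuousMap.smul_apply, ContinuousMap.coe_mk,
      smul_eq_mul, e]
    have hd' := hd.ne'
    generalize r * (s x * t x) = q at hd' ⊢
    field_simp
    ring
  rw [Real.dist_eq, key, abs_div, abs_neg, abs_mul, abs_of_pos hd, div_lt_iff₀ hd]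
  have h1 : |s x + t x| ≤ 2 * M := (abs_add_le _ _).trans (by linarith [hsM x, htM x])
  calc |s x + t x| * |r * (s x * t x)| ≤ 2 * M * (r * M ^ 2) := by
        gcongr
        exact hq x
    _ = 4 * M ^ 3 * r * (1 / 2) := by ring
    _ < ε * (1 / 2) := by gcongr
    _ ≤ ε * (1 - r * (s x * t x)) := by gcongr

/-- The uniform closure of `RUSFun.tanSet U` is a subalgebra of `C(U, ℝ)`. -/
def tanSubalgebra (U : Set ℝ) [CompactSpace U] : Subalgebra ℝ C(U, ℝ) where
  carrier := closure (tanSet U)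
  mul_mem' hs ht := map_mem_closure₂ continuous_mul hs ht fun _ ha _ hb => mul_mem_tanSet ha hb
  add_mem' hs ht := by
    rw [← closure_closure]
    exact map_mem_closure₂ continuous_add hs ht fun _ ha _ hb => add_mem_closure_tanSet ha hb
  algebraMap_mem' c := subset_closure (const_mem_tanSet c)

lemma separatesPoints_tanSubalgebra : (tanSubalgebra U).SeparatesPoints := by
  obtain ⟨M, hM⟩ := (isCompact_iff_compactSpace.2 ‹CompactSpace U›).isBounded.exists_norm_le
  have hc : 0 < (|M| + 1)⁻¹ := by positivity
  set c := (|M| + 1)⁻¹ with hc_def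
  have hcx (x : U) : c * x ∈ Set.Ioo (-(π / 2)) (π / 2) := by
    have : |c * x| < 1 := by
      rw [abs_mul, abs_of_pos hc, hc_def, inv_mul_lt_iff₀ (by positivity)]
      have := hM x x.2
      rw [Real.norm_eq_abs] at this
      linarith [le_abs_self M]
    have := abs_lt.1 this
    constructor <;> linarith [pi_gt_three]
  let t : C(U, ℝ) := ⟨fun x => tan (c * x),
    continuousOn_tan_Ioo.comp_continuous (by fun_prop) hcx⟩
  intro x y hxy
  refine ⟨t, ⟨t, subset_closure ⟨_, RUSFun.linear c, fun z => ?_⟩, rfl⟩, fun h => hxy ?_⟩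
  · exact (arctan_tan (hcx z).1 (hcx z).2).symm
  · exact Subtype.ext (mul_left_cancel₀ hc.ne' (injOn_tan (hcx x) (hcx y) h))

lemma closure_tanSet_eq_univ : closure (tanSet U) = Set.univ := by
  have h := ContinuousMap.subalgebra_topologicalClosure_eq_top_of_separatesPoints
    (tanSubalgebra U) separatesPoints_tanSubalgebra
  have h' := congrArg (fun A : Subalgebra ℝ C(U, ℝ) => (A : Set C(U, ℝ))) h
  simpa [Subalgebra.topologicalClosure_coe, tanSubalgebra] using h'

/-- Rescaling before and after `arctan` recovers `t` in the limit. -/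
lemma exists_approx_of_mem_tanSet {t : C(U, ℝ)} (ht : t ∈ tanSet U) {ε : ℝ} (hε : 0 < ε) :
    ∃ g : ℝ → ℝ, RUSFun g ∧ ∀ x : U, |t x - g x| ≤ ε := by
  set M : ℝ := ‖t‖ + 1
  have hM0 : 0 < M := by positivity
  have htM (x : U) : |t x| ≤ M := (t.norm_coe_le_norm x).trans (by linarith)
  have hd : HasDerivAt arctan 1 0 := by simpa using hasDerivAt_arctan 0
  have hlo := (hasDerivAt_iff_isLittleO.1 hd).def (div_pos hε hM0)
  obtain ⟨δ, hδ, hball⟩ := Metric.eventually_nhds_iff.1 hlo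
  obtain ⟨n, hn⟩ := exists_nat_gt (M / δ)
  have hn0 : (0 : ℝ) < n := (div_pos hM0 hδ).trans hn
  obtain ⟨g, hg, hgt⟩ := smul_mem_tanSet (n : ℝ)⁻¹ ht
  refine ⟨_, hg.nsmul n, fun x => ?_⟩
  have hx : dist ((n : ℝ)⁻¹ * t x) 0 < δ := by
    rw [dist_zero_right, norm_mul, norm_inv, Real.norm_of_nonneg hn0.le,
      inv_mul_lt_iff₀ hn0, Real.norm_eq_abs]
    exact (htM x).trans_lt ((div_lt_iff₀ hδ).1 hn)
  have hb := hball hx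
  simp only [arctan_zero, sub_zero, smul_eq_mul, mul_one, Real.norm_eq_abs] at hb
  have e : t x - n * g x = -(n * (arctan ((n : ℝ)⁻¹ * t x) - (n : ℝ)⁻¹ * t x)) := by
    rw [hgt]
    simp only [ContinuousMap.smul_apply, smul_eq_mul]
    field_simp
    ring
  rw [e, abs_neg, abs_mul, abs_of_pos hn0]
  calc n * |arctan ((n : ℝ)⁻¹ * t x) - (n : ℝ)⁻¹ * t x|
      ≤ n * (ε / M * |(n : ℝ)⁻¹ * t x|) := by gcongr
    _ = ε / M * |t x| := by
        rw [abs_mul, abs_of_pos (inv_pos.2 hn0)]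
        field_simp
    _ ≤ ε / M * M := by gcongr; exact htM x
    _ = ε := div_mul_cancel₀ _ hM0.ne'

end RUSFun

/-- Theorem 3 of the paper: any function real-analytic on an open set containing a compact
set `U ⊂ ℝ` can be approximated on `U` to arbitrary accuracy using PAR, GB and addition. -/
theorem analytic_RUS_approx (U : Set ℝ) (hU : IsCompact U)
    (V : Set ℝ) (hV : IsOpen V) (hUV : U ⊆ V)
    (h : ℝ → ℝ) (hh : ∀ x ∈ V, AnalyticAt ℝ h x)
    (ε : ℝ) (hε : 0 < ε) :
    ∃ g : ℝ → ℝ, RUSFun g ∧ ∀ x ∈ U, |h x - g x| ≤ ε := by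
  have : CompactSpace U := isCompact_iff_compactSpace.1 hU
  have hc : ContinuousOn h U := fun x hx => (hh x (hUV hx)).continuousAt.continuousWithinAt
  let φ : C(U, ℝ) := ⟨U.domRestrict h, hc.domRestrict⟩
  have hφ : φ ∈ closure (RUSFun.tanSet U) := by simp [RUSFun.closure_tanSet_eq_univ]
  obtain ⟨t, ht, hφt⟩ := Metric.mem_closure_iff.1 hφ (ε / 2) (half_pos hε)
  obtain ⟨g, hg, htg⟩ := RUSFun.exists_approx_of_mem_tanSet ht (half_pos hε)
  refine ⟨g, hg, fun x hx => ?_⟩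
  have h1 : |h x - t ⟨x, hx⟩| < ε / 2 :=
    (ContinuousMap.dist_apply_le_dist (f := φ) (g := t) ⟨x, hx⟩).trans_lt hφt
  linarith [abs_sub_le (h x) (t ⟨x, hx⟩) (g x), htg ⟨x, hx⟩]
end

section
/- Let 𝔉 be the smallest set of functions ℝ → ℝ containing all constant functions and all linear functions x ↦ c·x (c ∈ ℝ), and closed under: pointwise addition (f,g) ↦ f + g; PAR-combination (f,g) ↦ (x ↦ arctan(tan(f(x)) · tan(g(x)))); and GB-combination (f,g) ↦ (x ↦ arctan(tan²(arcsin(|sin(f(x))| · |sin(g(x))|)))). Let [α,β] ⊂ ℝ be a compact interval and let h : [α,β] → ℝ be bounded and continuous except at finitely many points (piecewise continuous). Then for every ε > 0 there exists g ∈ 𝔉 with (∫_α^β |h(x) − g(x)|² dx)^{1/2} ≤ ε. (Corollary: any piecewise continuous function on a compact domain can be approximated to arbitrarily small error in the 2-norm using PAR, GB and addition.) -/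
open Real

open MeasureTheory Filter Topology Set
open scoped ENNReal

namespace RUSFun

theorem measurable {f : ℝ → ℝ} (hf : RUSFun f) : Measurable f := by
  have htan : Measurable Real.tan := by
    have : Real.tan = fun x => Real.sin x / Real.cos x := funext Real.tan_eq_sin_div_cos
    rw [this]
    fun_prop
  induction hf with
  | const c => exact measurable_const
  | linear c => exact measurable_id.const_mul c
  | add _ _ hf hg => exact hf.add hg
  | par _ _ hf hg => exact ((htan.comp hf).mul (htan.comp hg)).arctan
  | gb _ _ hf hg =>
    have hu := (hf.sin.abs).mul hg.sin.abs
    exact ((htan.comp (measurable_arcsin.comp hu)).pow_const 2).arctan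

theorem arctan_tan_pow {u : ℝ → ℝ} (hu : RUSFun u) (n : ℕ) :
    RUSFun fun x => Real.arctan (Real.tan (u x) ^ n) := by
  induction n with
  | zero => simpa using const (Real.arctan 1)
  | succ n ih => simpa [Real.tan_arctan, pow_succ] using par ih hu

end RUSFun

theorem tendsto_eLpNorm_two_sub_of_bounded {Ω : Type*} [MeasurableSpace Ω] {μ : Measure Ω}
    [IsFiniteMeasure μ] {F : ℕ → Ω → ℝ} {f : Ω → ℝ} (hF : ∀ n, Measurable (F n))
    (hf : Measurable f) {C : ℝ} (hC : ∀ n x, |F n x - f x| ≤ C)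
    (hlim : ∀ᵐ x ∂μ, Tendsto (fun n => F n x) atTop (𝓝 (f x))) :
    Tendsto (fun n => eLpNorm (F n - f) 2 μ) atTop (𝓝 0) := by
  simp only [eLpNorm_eq_lintegral_rpow_enorm_toReal two_ne_zero ENNReal.ofNat_ne_top]
  have key : Tendsto (fun n => ∫⁻ x, ‖(F n - f) x‖ₑ ^ (2 : ℝ≥0∞).toReal ∂μ) atTop
      (𝓝 (∫⁻ _, 0 ∂μ)) := by
    refine tendsto_lintegral_of_dominated_convergence
      (fun _ => ENNReal.ofReal C ^ (2 : ℝ≥0∞).toReal)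
      (fun n => ((hF n).sub hf).enorm.pow_const _) (fun n => ae_of_all _ fun x => ?_) ?_ ?_
    · refine ENNReal.rpow_le_rpow ?_ (by simp)
      rw [Real.enorm_eq_ofReal_abs]
      exact ENNReal.ofReal_le_ofReal (hC n x)
    · rw [lintegral_const]
      exact ENNReal.mul_ne_top (by simp) (measure_ne_top _ _)
    · filter_upwards [hlim] with x hx
      have h1 : Tendsto (fun n => ‖(F n - f) x‖ₑ) atTop (𝓝 0) := by
        have := (hx.sub_const (f x)).enorm
        simpa using this
      simpa using h1.ennrpow_const (2 : ℝ≥0∞).toReal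
  simpa using key.ennrpow_const (1 / (2 : ℝ≥0∞).toReal)

/-- `φ` is an `L²(μ)`-limit of functions satisfying `RUSFun`. -/
def RUSApprox (μ : Measure ℝ) (φ : ℝ → ℝ) : Prop :=
  ∀ ε : ℝ≥0∞, ε ≠ 0 → ∃ g, eLpNorm (g - φ) 2 μ ≤ ε ∧ RUSFun g

namespace RUSApprox

variable {μ : Measure ℝ} {φ ψ : ℝ → ℝ}

theorem of_tendsto {φs : ℕ → ℝ → ℝ} (h : ∀ n, RUSApprox μ (φs n))
    (hm : ∀ n, Measurable (φs n)) (hφ : Measurable φ)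
    (hlim : Tendsto (fun n => eLpNorm (φs n - φ) 2 μ) atTop (𝓝 0)) : RUSApprox μ φ := by
  intro ε hε
  have hε2 : ε / 2 ≠ 0 := (ENNReal.half_pos hε).ne'
  obtain ⟨n, hn⟩ := (hlim.eventually_le_const (pos_iff_ne_zero.2 hε2)).exists
  obtain ⟨g, hg, hgR⟩ := h n _ hε2
  refine ⟨g, ?_, hgR⟩
  have := eLpNorm_add_le (hgR.measurable.sub (hm n)).aestronglyMeasurable
    ((hm n).sub hφ).aestronglyMeasurable (μ := μ) one_le_two
  rw [sub_add_sub_cancel] at this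
  exact this.trans ((add_le_add hg hn).trans_eq (ENNReal.add_halves ε))

theorem add (hφ : Measurable φ) (hψ : Measurable ψ) (h₁ : RUSApprox μ φ)
    (h₂ : RUSApprox μ ψ) : RUSApprox μ (φ + ψ) := by
  intro ε hε
  have hε2 : ε / 2 ≠ 0 := (ENNReal.half_pos hε).ne'
  obtain ⟨f, hf, hfR⟩ := h₁ _ hε2
  obtain ⟨g, hg, hgR⟩ := h₂ _ hε2
  refine ⟨f + g, ?_, hfR.add hgR⟩
  have := eLpNorm_add_le (hfR.measurable.sub hφ).aestronglyMeasurable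
    (hgR.measurable.sub hψ).aestronglyMeasurable (μ := μ) one_le_two
  rw [sub_add_sub_comm] at this
  exact this.trans ((add_le_add hf hg).trans_eq (ENNReal.add_halves ε))

theorem of_RUSFun (h : RUSFun φ) : RUSApprox μ φ := fun ε _ => ⟨φ, by simp, h⟩

theorem nsmul (hφ : Measurable φ) (h : RUSApprox μ φ) (n : ℕ) : RUSApprox μ (n • φ) := by
  induction n with
  | zero => simpa using! of_RUSFun (RUSFun.const 0)
  | succ n ih =>
    rw [succ_nsmul]
    exact add (hφ.const_smul n) hφ ih h

end RUSApprox

theorem Real.one_lt_tan_of_mem_Ioo {u : ℝ} (h₁ : π / 4 < u) (h₂ : u < π / 2) : 1 < tan u := by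
  rw [← tan_pi_div_four]
  exact tan_lt_tan_of_lt_of_lt_pi_div_two (by linarith [pi_pos]) h₂ h₁

theorem Real.tan_mem_Ioo_zero_one {u : ℝ} (h₁ : 0 < u) (h₂ : u < π / 4) :
    tan u ∈ Ioo (0 : ℝ) 1 := by
  refine ⟨tan_pos_of_pos_of_lt_pi_div_two h₁ (by linarith), ?_⟩
  rw [← tan_pi_div_four]
  exact tan_lt_tan_of_lt_of_lt_pi_div_two (by linarith) (by linarith [pi_pos]) h₂

section Step

variable {α β : ℝ}

theorem RUSApprox.step_of_arctan (t K : ℝ) :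
    RUSApprox (volume.restrict (Ioc α β)) ((Ioi t).indicator fun _ => 2 * Real.arctan K) := by
  have hπ := Real.pi_pos
  set B : ℝ := |α| + |β| + |t| + 1
  have hB0 : 0 < B := by positivity
  set a : ℝ := π / 4 / B with ha
  have ha0 : 0 < a := by positivity
  have haB : a * B = π / 4 := by rw [ha]; field_simp
  set u : ℝ → ℝ := (fun x => a * x) + fun _ => π / 4 - a * t with hu
  have huR : RUSFun u := (RUSFun.linear a).add (RUSFun.const _)
  have hux : ∀ x, u x = a * (x - t) + π / 4 := fun x => by simp only [hu, Pi.add_apply]; ring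
  set F : ℕ → ℝ → ℝ := fun n x => Real.arctan K +
    Real.arctan (Real.tan (Real.arctan K) *
      Real.tan (Real.arctan (Real.tan (u x) ^ n) + -(π / 4))) with hF
  have hFR : ∀ n, RUSFun (F n) := fun n =>
    (RUSFun.const _).add ((RUSFun.const _).par ((huR.arctan_tan_pow n).add (RUSFun.const _)))
  have hsm : Measurable ((Ioi t).indicator fun _ => 2 * Real.arctan K) :=
    measurable_const.indicator measurableSet_Ioi
  refine .of_tendsto (fun n => .of_RUSFun (hFR n)) (fun n => (hFR n).measurable) hsm
    (tendsto_eLpNorm_two_sub_of_bounded (fun n => (hFR n).measurable) hsm (C := 2 * π) ?_ ?_)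
  · intro n x
    have h1 := Real.arctan_lt_pi_div_two K
    have h2 := Real.neg_pi_div_two_lt_arctan K
    simp only [hF]
    set y := Real.tan (Real.arctan K) * Real.tan (Real.arctan (Real.tan (u x) ^ n) + -(π / 4))
    have h3 := Real.arctan_lt_pi_div_two y
    have h4 := Real.neg_pi_div_two_lt_arctan y
    by_cases hx : x ∈ Ioi t
    · rw [indicator_of_mem hx, abs_le]
      constructor <;> linarith
    · rw [indicator_of_notMem hx, abs_le]
      constructor <;> linarith
  · have hne : ∀ᵐ x ∂(volume.restrict (Ioc α β)), x ≠ t :=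
      ae_restrict_of_ae (Measure.ae_ne volume t)
    filter_upwards [hne, ae_restrict_mem measurableSet_Ioc] with x hxt hx
    have hxB : |x - t| < B := by
      have := abs_le_max_abs_abs hx.1.le hx.2
      have h2 : max |α| |β| ≤ |α| + |β| := max_le_add_of_nonneg (abs_nonneg _) (abs_nonneg _)
      have := abs_sub x t
      linarith
    have hab : |a * (x - t)| < π / 4 := by
      rw [abs_mul, abs_of_pos ha0, ← haB]
      exact mul_lt_mul_of_pos_left hxB ha0
    rw [abs_lt] at hab
    have hlim : ∀ {l : ℝ}, Real.cos (l + -(π / 4)) ≠ 0 →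
        Tendsto (fun n : ℕ => Real.arctan (Real.tan (u x) ^ n)) atTop (𝓝 l) →
        Tendsto (fun n => F n x) atTop (𝓝 (Real.arctan K +
          Real.arctan (Real.tan (Real.arctan K) * Real.tan (l + -(π / 4))))) := by
      intro l hl hlim
      refine ((Real.continuous_arctan.tendsto _).comp
        (((Real.continuousAt_tan.2 hl).tendsto.comp (hlim.add_const _)).const_mul _)).const_add _
    rcases lt_or_gt_of_ne hxt with hlt | hgt
    · rw [indicator_of_notMem (by simpa using hlt.le)]
      have hax : a * (x - t) < 0 := mul_neg_of_pos_of_neg ha0 (by linarith)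
      have hT := Real.tan_mem_Ioo_zero_one (u := u x) (by rw [hux]; linarith)
        (by rw [hux]; linarith)
      have hl : Tendsto (fun n : ℕ => Real.arctan (Real.tan (u x) ^ n)) atTop (𝓝 0) := by
        simpa using! (Real.continuous_arctan.tendsto 0).comp
          (tendsto_pow_atTop_nhds_zero_of_lt_one hT.1.le hT.2)
      have := hlim (by simp [Real.cos_pi_div_four]) hl
      simpa [Real.tan_arctan, Real.tan_neg, Real.tan_pi_div_four, Real.arctan_neg] using this
    · rw [indicator_of_mem (by simpa using hgt)]
      have hax : 0 < a * (x - t) := mul_pos ha0 (by linarith)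
      have hT := Real.one_lt_tan_of_mem_Ioo (u := u x) (by rw [hux]; linarith)
        (by rw [hux]; linarith)
      have hl : Tendsto (fun n : ℕ => Real.arctan (Real.tan (u x) ^ n)) atTop (𝓝 (π / 2)) :=
        (Real.tendsto_arctan_atTop.mono_right nhdsWithin_le_nhds).comp
          (tendsto_pow_atTop_atTop_of_one_lt hT)
      have hq : π / 2 + -(π / 4) = π / 4 := by ring
      have := hlim (by rw [hq]; simp [Real.cos_pi_div_four]) hl
      simpa [hq, Real.tan_arctan, Real.tan_pi_div_four, two_mul] using this

theorem RUSApprox.step (t c : ℝ) :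
    RUSApprox (volume.restrict (Ioc α β)) ((Ioi t).indicator fun _ => c) := by
  obtain ⟨n, hn⟩ := exists_nat_gt |c|
  have hn0 : (0 : ℝ) < n := (abs_nonneg c).trans_lt hn
  have hc : |c / n| < 1 := by rwa [abs_div, Nat.abs_cast, div_lt_one hn0]
  rw [abs_lt] at hc
  have h1 := Real.pi_gt_three
  have harc : 2 * Real.arctan (Real.tan (c / n / 2)) = c / n := by
    rw [Real.arctan_tan (by linarith) (by linarith)]
    ring
  have := (step_of_arctan (α := α) (β := β) t (Real.tan (c / n / 2))).nsmul
    (measurable_const.indicator measurableSet_Ioi) n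
  rw [harc] at this
  convert this using 1
  ext x
  by_cases hx : x ∈ Ioi t
  · simp only [Pi.smul_apply, indicator_of_mem hx, nsmul_eq_mul]
    field_simp
  · simp only [Pi.smul_apply, indicator_of_notMem hx, smul_zero]

theorem RUSApprox.indicator_const {s : Set ℝ} (hs : MeasurableSet s) (c : ℝ) :
    RUSApprox (volume.restrict (Ioc α β)) (s.indicator fun _ => c) := by
  have hmeas : ∀ {s : Set ℝ} (c : ℝ), MeasurableSet s → Measurable (s.indicator fun _ => c) :=
    fun c hs => measurable_const.indicator hs
  induction s, hs using MeasurableSpace.induction_on_inter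
    ((BorelSpace.measurable_eq (α := ℝ)).trans (borel_eq_generateFrom_Ioi ℝ))
    isPiSystem_Ioi generalizing c with
  | empty => simpa using! of_RUSFun (RUSFun.const 0)
  | basic s hs =>
    obtain ⟨t, rfl⟩ := hs
    exact step t c
  | compl s hs ih =>
    convert (of_RUSFun (RUSFun.const c)).add measurable_const (hmeas (-c) hs) (ih (-c)) using 1
    ext x
    by_cases hx : x ∈ s <;> simp [hx]
  | iUnion f hd hf ih =>
    have hacc : ∀ n, MeasurableSet (accumulate f n) := fun n => .biUnion (to_countable _) fun i _ => hf i
    have happ : ∀ n, RUSApprox (volume.restrict (Ioc α β))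
        ((accumulate f n).indicator fun _ => c) := by
      intro n
      induction n with
      | zero => simpa using ih 0 c
      | succ n ihn =>
        rw [accumulate_succ, indicator_union_of_disjoint]
        · exact add (hmeas c (hacc n)) (hmeas c (hf _)) ihn (ih _ c)
        · exact disjoint_accumulate hd n.lt_succ_self
    refine of_tendsto happ (fun n => hmeas c (hacc n)) (hmeas c (.iUnion hf))
      (tendsto_eLpNorm_two_sub_of_bounded (fun n => hmeas c (hacc n)) (hmeas c (.iUnion hf))
        (C := |c| + |c|) (fun n x => (abs_sub _ _).trans (add_le_add ?_ ?_))
        (ae_of_all _ fun x => ?_))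
    · exact norm_indicator_le_norm_self (fun _ => c) x
    · exact norm_indicator_le_norm_self (fun _ => c) x
    · rw [← iUnion_accumulate]
      exact (monotone_accumulate.tendsto_indicator (accumulate f) (fun _ => c) x).mono_right
        (pure_le_nhds _)

end Step

/-- Corollary: any bounded function on a compact interval `[α, β]` that is continuous
except at finitely many points can be approximated to arbitrarily small error in the
2-norm using PAR, GB and addition. -/
theorem piecewise_continuous_RUS_L2_approx (α β : ℝ) (hαβ : α ≤ β) (h : ℝ → ℝ)
    (hbd : ∃ M : ℝ, ∀ x ∈ Set.Icc α β, |h x| ≤ M)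
    (hcont : ∃ S : Finset ℝ, ∀ x ∈ Set.Icc α β, x ∉ S →
      ContinuousWithinAt h (Set.Icc α β) x)
    (ε : ℝ) (hε : 0 < ε) :
    ∃ g : ℝ → ℝ, RUSFun g ∧ Real.sqrt (∫ x in α..β, (h x - g x) ^ 2) ≤ ε := by
  obtain ⟨M, hM⟩ := hbd
  obtain ⟨S, hS⟩ := hcont
  set μ := volume.restrict (Ioc α β)
  have hmeas : AEStronglyMeasurable h μ := by
    have hcont' : ContinuousOn h (Icc α β \ S) := fun x hx =>
      (hS x hx.1 (by simpa using hx.2)).mono sdiff_subset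
    have h1 := hcont'.aestronglyMeasurable (μ := volume)
      (measurableSet_Icc.diff S.measurableSet)
    rw [Measure.restrict_congr_set
      (sdiff_null_ae_eq_self (S.finite_toSet.measure_zero volume))] at h1
    exact h1.mono_measure (Measure.restrict_mono Ioc_subset_Icc_self le_rfl)
  have hLp : MemLp h 2 μ := by
    refine .of_bound hmeas M ?_
    filter_upwards [ae_restrict_mem measurableSet_Ioc] with x hx
    exact hM x (Ioc_subset_Icc_self hx)
  obtain ⟨g, hg, hgR⟩ := hLp.induction_dense ENNReal.ofNat_ne_top RUSFun
    (fun c s hs _ ε hε => RUSApprox.indicator_const hs c ε hε)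
    (fun f g hf hg => hf.add hg)
    (fun f hf => hf.measurable.aestronglyMeasurable)
    (ε := ENNReal.ofReal ε) (by simpa using hε)
  refine ⟨g, hgR, ?_⟩
  have hsub : MemLp (h - g) 2 μ :=
    ⟨hmeas.sub hgR.measurable.aestronglyMeasurable, hg.trans_lt ENNReal.ofReal_lt_top⟩
  rw [hsub.eLpNorm_eq_integral_rpow_norm two_ne_zero ENNReal.ofNat_ne_top,
    ENNReal.ofReal_le_ofReal_iff hε.le] at hg
  rw [intervalIntegral.integral_of_le hαβ, Real.sqrt_eq_rpow]
  simpa using hg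
end

section
/- Let 𝔉₂ be the smallest set of functions ℝ² → ℝ containing all constant functions and all functions (φ₁,φ₂) ↦ c·φ₁ and (φ₁,φ₂) ↦ c·φ₂ (c ∈ ℝ), and closed under: pointwise addition; PAR-combination (f,g) ↦ arctan(tan(f) · tan(g)); and GB-combination (f,g) ↦ arctan(tan²(arcsin(|sin(f)| · |sin(g)|))). Then for every even integer q ≥ 2 there exist g ∈ 𝔉₂ and constants C > 0, δ > 0 such that for all (φ₁,φ₂) with max(|φ₁|,|φ₂|) ≤ δ, |g(φ₁,φ₂) − φ₁φ₂| ≤ C · max(|φ₁|,|φ₂|)^{q+2}. (Lemma 4: multiplication formulas of arbitrarily high order can be built from PAR and GB circuits.) -/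
open Real

/-- The smallest set of functions `ℝ × ℝ → ℝ` (curried) containing all constants and all
functions `(φ₁,φ₂) ↦ c·φ₁` and `(φ₁,φ₂) ↦ c·φ₂`, and closed under pointwise addition,
PAR-combination and GB-combination. -/
inductive RUSFun2 : (ℝ → ℝ → ℝ) → Prop
  | const (c : ℝ) : RUSFun2 fun _ _ => c
  | lin1 (c : ℝ) : RUSFun2 fun x _ => c * x
  | lin2 (c : ℝ) : RUSFun2 fun _ y => c * y
  | add {f g : ℝ → ℝ → ℝ} : RUSFun2 f → RUSFun2 g → RUSFun2 fun x y => f x y + g x y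
  | par {f g : ℝ → ℝ → ℝ} : RUSFun2 f → RUSFun2 g →
      RUSFun2 fun x y => Real.arctan (Real.tan (f x y) * Real.tan (g x y))
  | gb {f g : ℝ → ℝ → ℝ} : RUSFun2 f → RUSFun2 g →
      RUSFun2 fun x y =>
        Real.arctan (Real.tan (Real.arcsin (|Real.sin (f x y)| * |Real.sin (g x y)|)) ^ 2)

open Asymptotics Topology Filter

namespace RUSFun2

theorem finset_sum {ι : Type*} (s : Finset ι) {f : ι → ℝ → ℝ → ℝ}
    (hf : ∀ i ∈ s, RUSFun2 (f i)) : RUSFun2 fun x y => ∑ i ∈ s, f i x y := by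
  classical
  induction s using Finset.induction_on with
  | empty => simpa using RUSFun2.const 0
  | insert a s ha ih =>
    simp only [Finset.sum_insert ha]
    exact (hf a (by simp)).add (ih fun i hi => hf i (by simp [hi]))

end RUSFun2

/-- The two coordinates of a point of the plane. -/
def planeCoord (b : Bool) (z : ℝ × ℝ) : ℝ := bif b then z.1 else z.2

/-- The standard basis of the plane, indexed compatibly with `planeCoord`. -/
def planeBasis (b : Bool) : ℝ × ℝ := bif b then (1, 0) else (0, 1)

theorem sum_planeCoord_smul_planeBasis (z : ℝ × ℝ) :
    ∑ b, planeCoord b z • planeBasis b = z := by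
  ext <;> simp [planeCoord, planeBasis]

theorem analyticAt_planeCoord (b : Bool) (z : ℝ × ℝ) : AnalyticAt ℝ (planeCoord b) z := by
  cases b
  · exact analyticAt_snd
  · exact analyticAt_fst

theorem isBigO_planeCoord (b : Bool) : planeCoord b =O[𝓝 0] fun z : ℝ × ℝ => ‖z‖ ^ 1 := by
  refine IsBigO.of_bound 1 (Eventually.of_forall fun z => ?_)
  cases b
  · simpa [planeCoord] using norm_snd_le z
  · simpa [planeCoord] using norm_fst_le z

theorem RUSFun2.planeCoord (b : Bool) : RUSFun2 fun x y => planeCoord b (x, y) := by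
  cases b
  · simpa [_root_.planeCoord] using RUSFun2.lin2 1
  · simpa [_root_.planeCoord] using RUSFun2.lin1 1

/-- Iterated PAR-combination of coordinates with a constant prefactor. -/
noncomputable def parMonomial {n : ℕ} (c : ℝ) (r : Fin n → Bool) (z : ℝ × ℝ) : ℝ :=
  arctan (c * ∏ i, tan (planeCoord (r i) z))

theorem RUSFun2.parMonomial {n : ℕ} (c : ℝ) (r : Fin n → Bool) :
    RUSFun2 fun x y => parMonomial c r (x, y) := by
  induction n with
  | zero => simpa [_root_.parMonomial] using RUSFun2.const (arctan c)
  | succ n ih =>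
    convert (RUSFun2.planeCoord (r 0)).par (ih fun i => r i.succ) using 3
    simp only [_root_.parMonomial, Fin.prod_univ_succ, tan_arctan]
    ring_nf

theorem analyticAt_tan_zero : AnalyticAt ℝ tan 0 := by
  have h : tan = fun x => sin x / cos x := funext tan_eq_sin_div_cos
  rw [h]
  exact analyticAt_sin.div analyticAt_cos (by simp)

theorem analyticAt_real_arctan (x : ℝ) : AnalyticAt ℝ arctan x :=
  (contDiff_arctan (n := ⊤)).contDiffAt.analyticAt

theorem analyticAt_parMonomial {n : ℕ} (c : ℝ) (r : Fin n → Bool) :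
    AnalyticAt ℝ (parMonomial c r) 0 := by
  refine (analyticAt_real_arctan _).comp (analyticAt_const.mul ?_)
  refine Finset.analyticAt_fun_prod _ fun i _ => ?_
  have h0 : planeCoord (r i) 0 = 0 := by cases r i <;> rfl
  exact AnalyticAt.comp (g := tan) (h0 ▸ analyticAt_tan_zero) (analyticAt_planeCoord (r i) 0)

/-- An analytic function with value `0` and derivative `1` at `0` is the identity to second
order. -/
theorem AnalyticAt.isBigO_sub_id {f : ℝ → ℝ} (hf : AnalyticAt ℝ f 0) (h0 : f 0 = 0)
    (h1 : HasDerivAt f 1 0) : (fun x => f x - x) =O[𝓝 0] fun x => x ^ 2 := by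
  obtain ⟨p, hp⟩ := hf
  have h := hp.isBigO_sub_partialSum_pow 2
  have hd : p 1 (fun _ => 1) = 1 := by rw [← hp.deriv, h1.deriv]
  have hp1 (y : ℝ) : p 1 (fun _ => y) = y := by
    have := (p 1).map_smul_univ (fun _ => y) (fun _ => (1 : ℝ))
    simpa [hd] using this
  have hp0 (y : ℝ) : p 0 (fun _ => y) = 0 := by rw [← h0]; exact hp.coeff_zero _
  simp only [FormalMultilinearSeries.partialSum, Finset.sum_range_succ, Finset.sum_range_zero,
    hp0, hp1, zero_add] at h
  simpa [← norm_pow] using h.norm_right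

theorem isBigO_tan_sub_id : (fun x => tan x - x) =O[𝓝 0] fun x : ℝ => x ^ 2 :=
  analyticAt_tan_zero.isBigO_sub_id tan_zero (by simpa using hasDerivAt_tan (x := 0) (by simp))

theorem isBigO_arctan_sub_id : (fun x => arctan x - x) =O[𝓝 0] fun x : ℝ => x ^ 2 :=
  (analyticAt_real_arctan 0).isBigO_sub_id arctan_zero (by simpa using hasDerivAt_arctan 0)

theorem isBigO_norm_pow_of_le {m n : ℕ} (h : m ≤ n) :
    (fun z : ℝ × ℝ => ‖z‖ ^ n) =O[𝓝 0] fun z => ‖z‖ ^ m := by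
  refine IsBigO.of_bound 1 ?_
  filter_upwards [Metric.ball_mem_nhds (0 : ℝ × ℝ) one_pos] with z hz
  have hz : ‖z‖ < 1 := by simpa using hz
  simpa using pow_le_pow_of_le_one (norm_nonneg z) hz.le h

theorem tendsto_planeCoord (b : Bool) : Tendsto (planeCoord b) (𝓝 0) (𝓝 0) := by
  have := (analyticAt_planeCoord b 0).continuousAt.tendsto
  have h0 : planeCoord b 0 = 0 := by cases b <;> rfl
  rwa [h0] at this

theorem isBigO_tan_planeCoord_sub (b : Bool) :
    (fun z => tan (planeCoord b z) - planeCoord b z) =O[𝓝 0] fun z : ℝ × ℝ => ‖z‖ ^ 2 := by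
  refine (isBigO_tan_sub_id.comp_tendsto (tendsto_planeCoord b)).trans ?_
  simpa [Function.comp_def] using (isBigO_planeCoord b).pow 2

theorem isBigO_prod_planeCoord {n : ℕ} (r : Fin n → Bool) :
    (fun z => ∏ i, planeCoord (r i) z) =O[𝓝 0] fun z : ℝ × ℝ => ‖z‖ ^ n := by
  simpa using IsBigO.finsetProd (s := Finset.univ) fun i _ => isBigO_planeCoord (r i)

theorem isBigO_prod_tan_sub {n : ℕ} (r : Fin n → Bool) :
    (fun z => ∏ i, tan (planeCoord (r i) z) - ∏ i, planeCoord (r i) z) =O[𝓝 0]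
      fun z : ℝ × ℝ => ‖z‖ ^ (n + 1) := by
  induction n with
  | zero => simpa using isBigO_zero _ _
  | succ n ih =>
    have ht : (fun z => tan (planeCoord (r 0) z)) =O[𝓝 0] fun z : ℝ × ℝ => ‖z‖ ^ 1 := by
      simpa using ((isBigO_tan_planeCoord_sub (r 0)).trans
        (isBigO_norm_pow_of_le one_le_two)).add (isBigO_planeCoord (r 0))
    have h1 := ht.mul (ih fun i => r i.succ)
    have h2 := (isBigO_tan_planeCoord_sub (r 0)).mul (isBigO_prod_planeCoord fun i => r i.succ)
    simp only [← pow_add] at h1 h2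
    rw [show 1 + (n + 1) = n + 1 + 1 by ring] at h1
    rw [show 2 + n = n + 1 + 1 by ring] at h2
    refine (h1.add h2).congr_left fun z => ?_
    simp only [Fin.prod_univ_succ]
    ring

theorem isBigO_parMonomial_sub {n : ℕ} (hn : n ≠ 0) (c : ℝ) (r : Fin n → Bool) :
    (fun z => parMonomial c r z - c * ∏ i, planeCoord (r i) z) =O[𝓝 0]
      fun z : ℝ × ℝ => ‖z‖ ^ (n + 1) := by
  have hd := (isBigO_prod_tan_sub r).const_mul_left c
  have hP : (fun z => c * ∏ i, tan (planeCoord (r i) z)) =O[𝓝 0] fun z : ℝ × ℝ => ‖z‖ ^ n := by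
    refine ((hd.trans (isBigO_norm_pow_of_le n.le_succ)).add
      ((isBigO_prod_planeCoord r).const_mul_left c)).congr_left fun z => ?_
    ring
  have h0 : Tendsto (fun z : ℝ × ℝ => ‖z‖ ^ n) (𝓝 0) (𝓝 0) := by
    have hc : Continuous fun z : ℝ × ℝ => ‖z‖ ^ n := by fun_prop
    simpa [hn] using hc.tendsto 0
  have ha : (fun z => parMonomial c r z - c * ∏ i, tan (planeCoord (r i) z)) =O[𝓝 0]
      fun z : ℝ × ℝ => ‖z‖ ^ (n + 1) := by
    refine (isBigO_arctan_sub_id.comp_tendsto (hP.trans_tendsto h0)).trans ?_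
    refine (hP.pow 2).trans ?_
    simp only [← pow_mul]
    exact isBigO_norm_pow_of_le (by omega)
  refine (ha.add hd).congr_left fun z => ?_
  ring

/-- Low-order Taylor terms of an analytic function vanish if the function vanishes to high
order. -/
theorem HasFPowerSeriesAt.apply_eq_zero_of_isBigO {f : ℝ × ℝ → ℝ}
    {p : FormalMultilinearSeries ℝ (ℝ × ℝ) ℝ} (hp : HasFPowerSeriesAt f p 0) {d : ℕ}
    (hf : f =O[𝓝 0] fun z => ‖z‖ ^ d) {i : ℕ} (hi : i < d) (z : ℝ × ℝ) :
    p i (fun _ => z) = 0 := by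
  induction i using Nat.strong_induction_on generalizing z with
  | _ i ih =>
    refine IsBigO.continuousMultilinearMap_apply_eq_zero (n := i) ?_ z
    have h := hp.isBigO_sub_partialSum_pow (i + 1)
    simp only [zero_add] at h
    refine ((hf.trans (isBigO_norm_pow_of_le (Nat.succ_le_of_lt hi))).sub h).congr_left
      fun y => ?_
    rw [FormalMultilinearSeries.partialSum, Finset.sum_range_succ, Finset.sum_eq_zero]
    · ring
    · exact fun j hj => ih j (Finset.mem_range.1 hj) ((Finset.mem_range.1 hj).trans hi) y

theorem ContinuousMultilinearMap.apply_diag_eq_sum_planeCoord {n : ℕ}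
    (p : ContinuousMultilinearMap ℝ (fun _ : Fin n => ℝ × ℝ) ℝ) (z : ℝ × ℝ) :
    p (fun _ => z) = ∑ r : Fin n → Bool,
      p (fun i => planeBasis (r i)) * ∏ i, planeCoord (r i) z := by
  conv_lhs => rw [← sum_planeCoord_smul_planeBasis z]
  rw [p.map_sum]
  refine Finset.sum_congr rfl fun r _ => ?_
  rw [p.map_smul_univ, smul_eq_mul, mul_comm]

/-- Every homogeneous polynomial agrees to leading order with an available circuit. -/
theorem exists_RUSFun2_sub_multilinear_isBigO {n : ℕ}
    (p : ContinuousMultilinearMap ℝ (fun _ : Fin n => ℝ × ℝ) ℝ) :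
    ∃ G : ℝ × ℝ → ℝ, RUSFun2 (fun x y => G (x, y)) ∧ AnalyticAt ℝ G 0 ∧
      (fun z => p (fun _ => z) - G z) =O[𝓝 0] fun z => ‖z‖ ^ (n + 1) := by
  rcases eq_or_ne n 0 with rfl | hn
  · refine ⟨fun _ => p fun _ => 0, .const _, analyticAt_const, ?_⟩
    refine (isBigO_zero _ _).congr_left fun z => ?_
    rw [Subsingleton.elim (fun _ => z) fun _ => 0, sub_self]
  · refine ⟨fun z => ∑ r : Fin n → Bool, parMonomial (p fun i => planeBasis (r i)) r z,
      .finset_sum _ fun r _ => .parMonomial _ r,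
      Finset.analyticAt_fun_sum _ fun r _ => analyticAt_parMonomial _ r, ?_⟩
    refine (IsBigO.sum (s := Finset.univ) fun (r : Fin n → Bool) _ =>
      (isBigO_parMonomial_sub hn (p fun i => planeBasis (r i)) r).neg_left).congr_left fun z => ?_
    rw [p.apply_diag_eq_sum_planeCoord, ← Finset.sum_sub_distrib]
    rw [Finset.sum_apply]
    exact Finset.sum_congr rfl fun r _ => by ring

/-- Available circuits approximate any analytic function to arbitrarily high order. -/
theorem AnalyticAt.exists_RUSFun2_sub_isBigO {F : ℝ × ℝ → ℝ} (hF : AnalyticAt ℝ F 0) (d : ℕ) :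
    ∃ G : ℝ × ℝ → ℝ, RUSFun2 (fun x y => G (x, y)) ∧ AnalyticAt ℝ G 0 ∧
      (fun z => F z - G z) =O[𝓝 0] fun z => ‖z‖ ^ d := by
  induction d with
  | zero =>
    refine ⟨fun _ => 0, .const 0, analyticAt_const, ?_⟩
    simpa using hF.continuousAt.tendsto.isBigO_one ℝ
  | succ d ih =>
    obtain ⟨G, hG, hGa, hFG⟩ := ih
    obtain ⟨p, hp⟩ := hF.fun_sub hGa
    obtain ⟨K, hK, hKa, hpK⟩ := exists_RUSFun2_sub_multilinear_isBigO (p d)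
    refine ⟨fun z => G z + K z, hG.add hK, hGa.fun_add hKa, ?_⟩
    have h := hp.isBigO_sub_partialSum_pow (d + 1)
    simp only [zero_add] at h
    refine (h.add hpK).congr_left fun z => ?_
    rw [FormalMultilinearSeries.partialSum, Finset.sum_range_succ, Finset.sum_eq_zero]
    · ring
    · exact fun j hj => hp.apply_eq_zero_of_isBigO hFG (Finset.mem_range.1 hj) z

/-- Lemma 4 of the paper: for each even `q ≥ 2` there is a multiplication formula built
from PAR and GB circuits with error `O(max(|φ₁|,|φ₂|)^(q+2))` near the origin. -/
theorem high_order_multiplication (q : ℕ) (hq : Even q) (hq2 : 2 ≤ q) :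
    ∃ g : ℝ → ℝ → ℝ, RUSFun2 g ∧ ∃ C > (0:ℝ), ∃ δ > (0:ℝ), ∀ φ₁ φ₂ : ℝ,
      max |φ₁| |φ₂| ≤ δ →
      |g φ₁ φ₂ - φ₁ * φ₂| ≤ C * max |φ₁| |φ₂| ^ (q + 2) := by
  obtain ⟨G, hG, -, hO⟩ := AnalyticAt.exists_RUSFun2_sub_isBigO
    (F := fun z : ℝ × ℝ => z.1 * z.2) (analyticAt_fst.fun_mul analyticAt_snd) (q + 2)
  obtain ⟨C, hC, hb⟩ := hO.exists_pos
  obtain ⟨ε, hε, hball⟩ := Metric.eventually_nhds_iff.1 hb.bound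
  refine ⟨_, hG, C, hC, ε / 2, half_pos hε, fun x y hxy => ?_⟩
  have hnorm : ‖(x, y)‖ = max |x| |y| := rfl
  have h := hball (y := (x, y)) (by rw [dist_zero_right, hnorm]; linarith)
  rw [norm_pow, norm_norm, hnorm] at h
  rw [abs_sub_comm]
  exact h
end

section
/- Let 𝔉₂ be the smallest set of functions ℝ² → ℝ containing all constant functions and all functions (φ₁,φ₂) ↦ c·φ₁ and (φ₁,φ₂) ↦ c·φ₂ (c ∈ ℝ), and closed under: pointwise addition; PAR-combination (f,g) ↦ arctan(tan(f) · tan(g)); and GB-combination (f,g) ↦ arctan(tan²(arcsin(|sin(f)| · |sin(g)|))). Then for every even integer q ≥ 2 there exist g ∈ 𝔉₂ and constants C > 0, δ > 0 such that for all (φ₁,φ₂) with max(|1−φ₁|,|1−φ₂|) ≤ δ, |g(φ₁,φ₂) − φ₁φ₂| ≤ C · max(|1−φ₁|,|1−φ₂|)^{q+2}; and likewise there exist g' ∈ 𝔉₂, C' > 0, δ' > 0 such that for all (φ₁,φ₂) with max(|φ₁|,|1−φ₂|) ≤ δ', |g'(φ₁,φ₂) − φ₁φ₂| ≤ C' ·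 max(|φ₁|,|1−φ₂|)^{q+2}. (Corollary 1: multiplication formulas accurate near φ₁ ≈ φ₂ ≈ 1 and near φ₁ ≈ 0, φ₂ ≈ 1.) -/
open Real

open Filter Topology Asymptotics Polynomial

/-- A one-variable function all of whose compositions with affine functions of `(x, y)` are
generated. -/
def IsRUSRidge (F : ℝ → ℝ) : Prop :=
  ∀ a b c : ℝ, RUSFun2 fun x y => F (a * x + b * y + c)

/-- Negation for values in `(-π / 2, π / 2)`, realized as a PAR-combination with a constant. -/
noncomputable def rusNeg (t : ℝ) : ℝ := Real.arctan (Real.tan t * Real.tan (-(π / 4)))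

lemma rusNeg_eq {t : ℝ} (ht : |t| < π / 2) : rusNeg t = -t := by
  have h := abs_lt.1 ht
  rw [rusNeg, Real.tan_neg, Real.tan_pi_div_four, mul_neg, mul_one, Real.arctan_neg,
    Real.arctan_tan (by linarith) h.2]

lemma RUSFun2.neg {f : ℝ → ℝ → ℝ} (hf : RUSFun2 f) : RUSFun2 fun x y => rusNeg (f x y) :=
  hf.par (.const _)

lemma RUSFun2.affine (a b c : ℝ) : RUSFun2 fun x y => a * x + b * y + c :=
  ((RUSFun2.lin1 a).add (.lin2 b)).add (.const c)

lemma IsRUSRidge.neg {F : ℝ → ℝ} (hF : IsRUSRidge F) : IsRUSRidge fun z => rusNeg (F z) :=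
  fun a b c => (hF a b c).neg

lemma IsRUSRidge.add {F G : ℝ → ℝ} (hF : IsRUSRidge F) (hG : IsRUSRidge G) :
    IsRUSRidge fun z => F z + G z :=
  fun a b c => (hF a b c).add (hG a b c)

lemma IsRUSRidge.comp_mul {F : ℝ → ℝ} (hF : IsRUSRidge F) (r : ℝ) :
    IsRUSRidge fun z => F (r * z) := by
  intro a b c
  have h : (fun x y : ℝ => F (r * (a * x + b * y + c))) =
      fun x y => F ((r * a) * x + (r * b) * y + r * c) := by
    ext x y
    ring_nf
  exact h ▸ hF _ _ _

lemma isRUSRidge_arctan_tan_mul_tan :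
    IsRUSRidge fun z => Real.arctan (Real.tan z * Real.tan z) :=
  fun a b c => (RUSFun2.affine a b c).par (.affine a b c)

lemma tendsto_zero_of_isBigO_sub_eval {F : ℝ → ℝ} {P : ℝ[X]} {N : ℕ} (hN : N ≠ 0)
    (h : (fun z => F z - P.eval z) =O[𝓝 0] fun z => z ^ N) (hP : P.coeff 0 = 0) :
    Tendsto F (𝓝 0) (𝓝 0) := by
  have h1 : Tendsto (fun z : ℝ => z ^ N) (𝓝 0) (𝓝 0) := by
    simpa [hN] using (continuous_pow N).tendsto (0 : ℝ)
  have h2 : Tendsto (fun z => P.eval z) (𝓝 0) (𝓝 0) := by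
    simpa [← coeff_zero_eq_eval_zero, hP] using P.continuous.tendsto (0 : ℝ)
  simpa using (h.trans_tendsto h1).add h2

lemma eventually_rusNeg_eq {α : Type*} {l : Filter α} {F : α → ℝ} (h : Tendsto F l (𝓝 0)) :
    ∀ᶠ z in l, rusNeg (F z) = -F z := by
  have h' : ∀ᶠ z in l, |F z| < π / 2 := by
    simpa [Real.dist_eq] using Metric.tendsto_nhds.1 h (π / 2) (by positivity)
  exact h'.mono fun z hz => rusNeg_eq hz

lemma exists_poly_isBigO_sub {g : ℝ → ℝ} (hg : AnalyticAt ℝ g 0) {N : ℕ} (hN : N ≠ 0) :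
    ∃ Q : ℝ[X], Q.coeff 0 = g 0 ∧ (fun z => g z - Q.eval z) =O[𝓝 0] fun z => z ^ N := by
  obtain ⟨p, hp⟩ := hg
  have hO := hp.isBigO_sub_partialSum_pow N
  have hev : ∀ z, (∑ k ∈ Finset.range N, C (p.coeff k) * X ^ k : ℝ[X]).eval z =
      p.partialSum N z := by
    intro z
    simp only [eval_finsetSum, eval_mul, eval_C, eval_pow, eval_X,
      FormalMultilinearSeries.partialSum, FormalMultilinearSeries.apply_eq_pow_smul_coeff,
      smul_eq_mul]
    exact Finset.sum_congr rfl fun _ _ => mul_comm _ _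
  have hO' : (fun z => g z - (∑ k ∈ Finset.range N, C (p.coeff k) * X ^ k : ℝ[X]).eval z)
      =O[𝓝 0] fun z => z ^ N := by
    refine (hO.trans ?_).congr_left fun z => by rw [hev, zero_add]
    exact .of_bound 1 (.of_forall fun z => by simp)
  refine ⟨_, ?_, hO'⟩
  obtain ⟨C, hC⟩ := hO'.bound
  have h0 := hC.self_of_nhds
  simp only [zero_pow hN, norm_zero, mul_zero, norm_le_zero_iff, sub_eq_zero] at h0
  rw [coeff_zero_eq_eval_zero, h0]

lemma exists_poly_arctan_tan_mul_tan {N : ℕ} (hN : N ≠ 0) :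
    ∃ P : ℝ[X], (fun z => Real.arctan (Real.tan z * Real.tan z) - P.eval z)
      =O[𝓝 0] (fun z => z ^ N) ∧ P.coeff 2 ≠ 0 ∧ ∀ j < 2, P.coeff j = 0 := by
  have htan : AnalyticAt ℝ Real.tan 0 := (Real.contDiffAt_tan.2 (by simp)).analyticAt
  have harc (x : ℝ) : AnalyticAt ℝ Real.arctan x := Real.contDiff_arctan.contDiffAt.analyticAt
  have hsq := htan.mul htan
  have otan : analyticOrderAt Real.tan 0 = 1 :=
    htan.analyticOrderAt_eq_one_of_zero_deriv_ne_zero (by simp) (by simp [Real.deriv_tan])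
  have oarc : analyticOrderAt Real.arctan 0 = 1 :=
    (harc 0).analyticOrderAt_eq_one_of_zero_deriv_ne_zero (by simp) (by simp [Real.deriv_arctan])
  have hcomp := (harc _).comp hsq
  have ho : analyticOrderAt (Real.arctan ∘ (Real.tan * Real.tan)) 0 = (2 : ℕ) := by
    rw [(harc _).analyticOrderAt_comp hsq]
    have : (fun x => (Real.tan * Real.tan) x - (Real.tan * Real.tan) 0) = Real.tan * Real.tan := by
      ext; simp
    rw [this, analyticOrderAt_mul htan htan, otan]
    simp only [Pi.mul_apply, Real.tan_zero, mul_zero, oarc]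
    norm_num
  obtain ⟨g, hg, hg0, hfg⟩ := hcomp.analyticOrderAt_eq_natCast.1 ho
  obtain ⟨Q, hQ0, hQ⟩ := exists_poly_isBigO_sub hg hN
  refine ⟨X ^ 2 * Q, ?_, ?_, fun j hj => ?_⟩
  · have h1 : (fun z : ℝ => z ^ 2) =O[𝓝 0] fun _ => (1 : ℝ) :=
      ((continuous_pow 2).tendsto (0 : ℝ)).isBigO_one ℝ
    refine (h1.mul hQ).congr' ?_ (.of_eq <| by ext; simp)
    filter_upwards [hfg] with z hz
    simp only [Function.comp, Pi.mul_apply, sub_zero, smul_eq_mul] at hz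
    simp [hz, mul_sub]
  · simpa [coeff_X_pow_mul', hQ0] using hg0
  · simp [coeff_X_pow_mul', hj]

/-- Combining `F (r * z)` with two negated copies of `F`, where `r ^ k = 2`, removes the
coefficient of degree `k` and multiplies each of the others by a constant. -/
lemma exists_isRUSRidge_coeff_eq_zero {N : ℕ} (hN : N ≠ 0) {k : ℕ} (hk : 2 ≤ k) :
    ∃ F : ℝ → ℝ, IsRUSRidge F ∧ ∃ P : ℝ[X],
      (fun z => F z - P.eval z) =O[𝓝 0] (fun z => z ^ N) ∧ P.coeff 2 ≠ 0 ∧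
      ∀ j ≤ k, j ≠ 2 → P.coeff j = 0 := by
  induction k, hk using Nat.le_induction with
  | base =>
    obtain ⟨P, hP, hP2, hPj⟩ := exists_poly_arctan_tan_mul_tan hN
    exact ⟨_, isRUSRidge_arctan_tan_mul_tan, P, hP, hP2, fun j hj hj2 => hPj j (by omega)⟩
  | succ k hk ih =>
    obtain ⟨F, hF, P, hP, hP2, hPj⟩ := ih
    set r : ℝ := 2 ^ ((k + 1 : ℕ) : ℝ)⁻¹ with hr
    have hr1 : 1 < r := Real.one_lt_rpow (by norm_num) (by positivity)
    have hrk : r ^ (k + 1) = 2 := Real.rpow_inv_natCast_pow (by norm_num) (by omega)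
    have hr2 : r ^ 2 < 2 := hrk ▸ pow_lt_pow_right₀ hr1 (by omega)
    have hcoeff (j : ℕ) : (P.comp (C r * X) - 2 * P).coeff j = P.coeff j * (r ^ j - 2) := by
      rw [coeff_sub, comp_C_mul_X_coeff, ← C_ofNat, coeff_C_mul]
      ring
    refine ⟨_, (hF.comp_mul r).add (hF.neg.add hF.neg), P.comp (C r * X) - 2 * P, ?_, ?_, ?_⟩
    · have hT : Tendsto (fun z : ℝ => r * z) (𝓝 0) (𝓝 0) := by
        simpa using (continuous_const_mul r).tendsto (0 : ℝ)
      have h1 : (fun z => F (r * z) - P.eval (r * z)) =O[𝓝 0] fun z => z ^ N := by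
        refine (hP.comp_tendsto hT).trans ?_
        simp only [Function.comp_def, mul_pow]
        exact isBigO_const_mul_self _ _ _
      refine (h1.sub (hP.const_mul_left 2)).congr' ?_ .rfl
      filter_upwards [eventually_rusNeg_eq <|
        tendsto_zero_of_isBigO_sub_eval hN hP (hPj 0 (by omega) (by omega))] with z hz
      simp [hz]
      ring
    · rw [hcoeff]
      exact mul_ne_zero hP2 (by linarith)
    · intro j hj hj2
      rw [hcoeff]
      rcases hj.eq_or_lt with rfl | hj
      · simp [hrk]
      · simp [hPj j (by omega) hj2]

/-- The square is generated up to an error of arbitrarily high order at `0`. -/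
lemma exists_isRUSRidge_sub_sq_isBigO {N : ℕ} (hN : 2 < N) :
    ∃ F : ℝ → ℝ, IsRUSRidge F ∧ (fun z => F z - z ^ 2) =O[𝓝 0] fun z => z ^ N := by
  obtain ⟨F, hF, P, hP, hP2, hPj⟩ :=
    exists_isRUSRidge_coeff_eq_zero (N := N) (k := N) (by omega) hN.le
  set c := P.coeff 2
  have hF0 : Tendsto F (𝓝 0) (𝓝 0) :=
    tendsto_zero_of_isBigO_sub_eval (by omega) hP (hPj 0 (by omega) (by omega))
  have hdvd : X ^ N ∣ P - C c * X ^ 2 := by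
    refine X_pow_dvd_iff.2 fun d hd => ?_
    by_cases h : d = 2
    · simp [h, c]
    · simp [coeff_X_pow, h, hPj d hd.le h]
  obtain ⟨R, hR⟩ := hdvd
  have hFc : (fun z => F z - c * z ^ 2) =O[𝓝 0] fun z => z ^ N := by
    have h1 : (fun z => z ^ N * R.eval z) =O[𝓝 0] fun z => z ^ N := by
      simpa using (isBigO_refl (fun z : ℝ => z ^ N) (𝓝 0)).mul
        ((R.continuous.tendsto (0 : ℝ)).isBigO_one ℝ)
    refine (hP.add h1).congr_left fun z => ?_
    have := congrArg (eval z) hR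
    simp at this
    linarith
  obtain ⟨G, hG, d, hd, hGd⟩ : ∃ G : ℝ → ℝ, IsRUSRidge G ∧ ∃ d > 0,
      (fun z => G z - d * z ^ 2) =O[𝓝 0] fun z => z ^ N := by
    rcases lt_or_gt_of_ne hP2 with h | h
    · refine ⟨_, hF.neg, -c, by linarith, hFc.neg_left.congr' ?_ .rfl⟩
      filter_upwards [eventually_rusNeg_eq hF0] with z hz
      rw [hz]
      ring
    · exact ⟨F, hF, c, h, hFc⟩
  set s := (√d)⁻¹
  have hs : d * s ^ 2 = 1 := by
    rw [inv_pow, Real.sq_sqrt hd.le, mul_inv_cancel₀ hd.ne']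
  refine ⟨_, hG.comp_mul s, ?_⟩
  have hT : Tendsto (fun z : ℝ => s * z) (𝓝 0) (𝓝 0) := by
    simpa using (continuous_const_mul s).tendsto (0 : ℝ)
  have h2 := hGd.comp_tendsto hT
  simp only [Function.comp_def, mul_pow, ← mul_assoc, hs, one_mul] at h2
  exact h2.trans (isBigO_const_mul_self _ _ _)

/-- Products are generated up to an error of arbitrarily high order near any base point. -/
lemma exists_rusFun2_sub_mul_le {N : ℕ} (hN : 2 < N) (p₁ p₂ : ℝ) :
    ∃ g : ℝ → ℝ → ℝ, RUSFun2 g ∧ ∃ C > (0 : ℝ), ∃ δ > (0 : ℝ), ∀ x y : ℝ,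
      max |x - p₁| |y - p₂| ≤ δ →
      |g x y - (x - p₁) * (y - p₂)| ≤ C * max |x - p₁| |y - p₂| ^ N := by
  obtain ⟨S, hS, hSO⟩ := exists_isRUSRidge_sub_sq_isBigO hN
  have hS0 : Tendsto S (𝓝 0) (𝓝 0) :=
    tendsto_zero_of_isBigO_sub_eval (P := X ^ 2) (N := N) (by omega) (by simpa using hSO) (by simp)
  obtain ⟨K, hK, hKb⟩ := hSO.exists_pos
  obtain ⟨ε, hε, hb⟩ := Metric.eventually_nhds_iff.1 (hKb.bound.and (eventually_rusNeg_eq hS0))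
  refine ⟨_, (hS (1 / 2) (1 / 2) (-(p₁ + p₂) / 2)).add
    (hS (1 / 2) (-(1 / 2)) (-(p₁ - p₂) / 2)).neg, 2 * K, by positivity, ε / 2, by positivity, ?_⟩
  intro x y hxy
  set M := max |x - p₁| |y - p₂|
  have hx : |x - p₁| ≤ M := le_max_left _ _
  have hy : |y - p₂| ≤ M := le_max_right _ _
  have hbd {z : ℝ} (hz : |z| ≤ M) : |S z - z ^ 2| ≤ K * M ^ N ∧ rusNeg (S z) = -S z := by
    have h := hb (y := z) (by rw [Real.dist_eq, sub_zero]; linarith)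
    refine ⟨h.1.trans ?_, h.2⟩
    rw [norm_pow, Real.norm_eq_abs]
    gcongr
  rw [abs_le] at hx hy
  obtain ⟨h1, -⟩ := hbd (z := 1 / 2 * x + 1 / 2 * y + -(p₁ + p₂) / 2)
    (abs_le.2 ⟨by linarith, by linarith⟩)
  obtain ⟨h2, h2'⟩ := hbd (z := 1 / 2 * x + -(1 / 2) * y + -(p₁ - p₂) / 2)
    (abs_le.2 ⟨by linarith, by linarith⟩)
  rw [h2']
  rw [abs_le] at h1 h2 ⊢
  constructor <;> nlinarith

/-- Corollary 1 of the paper: multiplication formulas of arbitrarily high (even) order `q`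
built from PAR and GB circuits, accurate near `φ₁ ≈ φ₂ ≈ 1`, and likewise near
`φ₁ ≈ 0, φ₂ ≈ 1`. -/
theorem high_order_multiplication_shifted (q : ℕ) (hq : Even q) (hq2 : 2 ≤ q) :
    (∃ g : ℝ → ℝ → ℝ, RUSFun2 g ∧ ∃ C > (0:ℝ), ∃ δ > (0:ℝ), ∀ φ₁ φ₂ : ℝ,
      max |1 - φ₁| |1 - φ₂| ≤ δ →
      |g φ₁ φ₂ - φ₁ * φ₂| ≤ C * max |1 - φ₁| |1 - φ₂| ^ (q + 2)) ∧
    (∃ g' : ℝ → ℝ → ℝ, RUSFun2 g' ∧ ∃ C' > (0:ℝ), ∃ δ' > (0:ℝ), ∀ φ₁ φ₂ : ℝ,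
      max |φ₁| |1 - φ₂| ≤ δ' →
      |g' φ₁ φ₂ - φ₁ * φ₂| ≤ C' * max |φ₁| |1 - φ₂| ^ (q + 2)) := by
  constructor
  · obtain ⟨g, hg, C, hC, δ, hδ, h⟩ := exists_rusFun2_sub_mul_le (N := q + 2) (by omega) 1 1
    refine ⟨_, hg.add (.affine 1 1 (-1)), C, hC, δ, hδ, fun x y hxy => ?_⟩
    rw [abs_sub_comm 1 x, abs_sub_comm 1 y] at hxy ⊢
    convert h x y hxy using 2
    ring
  · obtain ⟨g, hg, C, hC, δ, hδ, h⟩ := exists_rusFun2_sub_mul_le (N := q + 2) (by omega) 0 1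
    refine ⟨_, hg.add (.affine 1 0 0), C, hC, δ, hδ, fun x y hxy => ?_⟩
    have h' := h x y
    rw [sub_zero] at h'
    rw [abs_sub_comm 1 y] at hxy ⊢
    convert h' hxy using 2
    ring
end

section
/- Fix a, b ∈ ℝ. There exist constants C > 0 and δ > 0 such that for all x with |x| ≤ δ, |arctan(tan(ax) · tan(bx)) − a b x² − (a b³ + a³ b) x⁴ / 3| ≤ C · x⁶. That is, PAR(ax, bx) = abx² + (ab³ + a³b)x⁴/3 + O(x⁶) as x → 0. -/
open Real

open Filter Topology Asymptotics in
/-- A function vanishing at `0` whose derivative is `O(xⁿ)` is `O(xⁿ⁺¹)`. -/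
theorem isBigO_pow_succ_of_hasDerivAt {f f' : ℝ → ℝ} {n : ℕ} (h0 : f 0 = 0)
    (hf : ∀ᶠ x in 𝓝 0, HasDerivAt f (f' x) x) (hf' : f' =O[𝓝 0] fun x => x ^ n) :
    f =O[𝓝 0] fun x => x ^ (n + 1) := by
  obtain ⟨C, hC⟩ := hf'.bound
  obtain ⟨ε, hε, hball⟩ := Metric.eventually_nhds_iff_ball.1 (hf.and hC)
  refine IsBigO.of_bound |C| ?_
  filter_upwards [Metric.ball_mem_nhds (0 : ℝ) hε] with x hx
  have hsub : Metric.closedBall (0 : ℝ) |x| ⊆ Metric.ball 0 ε :=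
    Metric.closedBall_subset_ball (by simpa using hx)
  have hC0 : ∀ y ∈ Metric.closedBall (0 : ℝ) |x|, ‖f' y‖ ≤ |C| * |x| ^ n := by
    intro y hy
    have hyx : |y| ≤ |x| := by simpa using hy
    calc ‖f' y‖ ≤ C * ‖y ^ n‖ := (hball y (hsub hy)).2
      _ ≤ |C| * |y| ^ n := by
        rw [norm_pow, Real.norm_eq_abs]
        gcongr
        exact le_abs_self C
      _ ≤ |C| * |x| ^ n := by gcongr
  have hmvt := (convex_closedBall (0 : ℝ) |x|).norm_image_sub_le_of_norm_hasDerivWithin_le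
    (fun y hy => (hball y (hsub hy)).1.hasDerivWithinAt) hC0
    (Metric.mem_closedBall_self (abs_nonneg x)) (y := x) (by simp)
  rw [h0, sub_zero, sub_zero] at hmvt
  rwa [norm_pow, pow_succ, ← mul_assoc]

open Filter Topology Asymptotics in
theorem tan_isBigO : tan =O[𝓝 0] fun x : ℝ => x := by
  have h := (hasDerivAt_tan (x := 0) (by simp)).differentiableAt.isBigO_sub
  simpa using h

open Filter Topology in
theorem eventually_hasDerivAt_tan :
    ∀ᶠ x : ℝ in 𝓝 0, HasDerivAt tan (1 + tan x ^ 2) x := by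
  have hc : ∀ᶠ x : ℝ in 𝓝 0, cos x ≠ 0 :=
    continuous_cos.continuousAt.eventually_ne (by simp)
  filter_upwards [hc] with x hx
  convert hasDerivAt_tan hx using 1
  rw [tan_eq_sin_div_cos]
  field_simp
  linarith [sin_sq_add_cos_sq x]

open Filter Topology Asymptotics in
theorem tan_sub_id_isBigO : (fun x : ℝ => tan x - x) =O[𝓝 0] fun x => x ^ 3 := by
  refine isBigO_pow_succ_of_hasDerivAt (f' := fun x => tan x ^ 2) (by simp) ?_ (tan_isBigO.pow 2)
  filter_upwards [eventually_hasDerivAt_tan] with x hx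
  exact (hx.sub (hasDerivAt_id x)).congr_deriv (by ring)

open Filter Topology Asymptotics in
theorem tan_sub_cubic_isBigO :
    (fun x : ℝ => tan x - (x + x ^ 3 / 3)) =O[𝓝 0] fun x => x ^ 5 := by
  refine isBigO_pow_succ_of_hasDerivAt (f' := fun x => (tan x - x) * (tan x + x)) (by simp) ?_ ?_
  · filter_upwards [eventually_hasDerivAt_tan] with x hx
    exact (hx.sub ((hasDerivAt_id x).add ((hasDerivAt_pow 3 x).div_const 3))).congr_deriv
      (by norm_num; ring)
  · exact (tan_sub_id_isBigO.mul (tan_isBigO.add (isBigO_refl _ _))).congr_right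
      fun x => by ring

open Filter Topology Asymptotics in
theorem arctan_sub_id_isBigO : (fun x : ℝ => arctan x - x) =O[𝓝 0] fun x => x ^ 3 := by
  refine isBigO_pow_succ_of_hasDerivAt (f' := fun x => 1 / (1 + x ^ 2) - 1) (by simp)
    (Eventually.of_forall fun x => (hasDerivAt_arctan x).sub (hasDerivAt_id x)) ?_
  refine IsBigO.of_bound 1 (Eventually.of_forall fun x => ?_)
  have hx : 0 < 1 + x ^ 2 := by positivity
  have : 1 / (1 + x ^ 2) - 1 = -(x ^ 2 / (1 + x ^ 2)) := by field_simp; ring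
  rw [this, norm_neg, one_mul, norm_of_nonneg (by positivity), norm_of_nonneg (by positivity)]
  exact div_le_self (by positivity) (by nlinarith [sq_nonneg x])

open Filter Topology Asymptotics in
theorem arctan_tan_mul_tan_isBigO (a b : ℝ) :
    (fun x : ℝ => arctan (tan (a * x) * tan (b * x)) - a * b * x ^ 2
      - (a * b ^ 3 + a ^ 3 * b) * x ^ 4 / 3) =O[𝓝 0] fun x => x ^ 6 := by
  have hlim (c : ℝ) : Tendsto (fun x : ℝ => c * x) (𝓝 0) (𝓝 0) :=
    Continuous.tendsto' (by fun_prop) _ _ (by simp)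
  have hmul (c : ℝ) : (fun x : ℝ => c * x) =O[𝓝 0] fun x => x := isBigO_const_mul_self c _ _
  have htan (c : ℝ) : (fun x : ℝ => tan (c * x)) =O[𝓝 0] fun x => x :=
    (tan_isBigO.comp_tendsto (hlim c)).trans (hmul c)
  have hcubic (c : ℝ) : (fun x : ℝ => tan (c * x) - (c * x + (c * x) ^ 3 / 3))
      =O[𝓝 0] fun x => x ^ 5 :=
    (tan_sub_cubic_isBigO.comp_tendsto (hlim c)).trans ((hmul c).pow 5)
  have hpoly : (fun x : ℝ => a * x + (a * x) ^ 3 / 3) =O[𝓝 0] fun x => x := by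
    simpa using (show DifferentiableAt ℝ (fun x : ℝ => a * x + (a * x) ^ 3 / 3) 0 by
      fun_prop).isBigO_sub
  have hprod : (fun x : ℝ => tan (a * x) * tan (b * x)) =O[𝓝 0] fun x => x ^ 2 :=
    ((htan a).mul (htan b)).congr_right fun x => by ring
  have hprod0 : Tendsto (fun x : ℝ => tan (a * x) * tan (b * x)) (𝓝 0) (𝓝 0) :=
    hprod.trans_tendsto (Continuous.tendsto' (by fun_prop) _ _ (by simp))
  have h1 : (fun x : ℝ => arctan (tan (a * x) * tan (b * x)) - tan (a * x) * tan (b * x))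
      =O[𝓝 0] fun x => x ^ 6 :=
    ((arctan_sub_id_isBigO.comp_tendsto hprod0).trans (hprod.pow 3)).congr_right
      fun x => by ring
  have h2 := ((hcubic a).mul (htan b)).congr_right (g₂ := fun x => x ^ 6) fun x => by ring
  have h3 := (hpoly.mul (hcubic b)).congr_right (g₂ := fun x => x ^ 6) fun x => by ring
  have h4 : (fun x : ℝ => a ^ 3 * b ^ 3 / 9 * x ^ 6) =O[𝓝 0] fun x => x ^ 6 :=
    isBigO_const_mul_self _ _ _
  exact (((h1.add h2).add h3).add h4).congr_left fun x => by ring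

/-- Taylor expansion of the two-input PAR angle function:
`PAR(ax, bx) = arctan(tan(ax)·tan(bx)) = abx² + (ab³ + a³b)x⁴/3 + O(x⁶)` as `x → 0`. -/
theorem par_fourth_order (a b : ℝ) :
    ∃ C > (0:ℝ), ∃ δ > (0:ℝ), ∀ x : ℝ, |x| ≤ δ →
      |Real.arctan (Real.tan (a * x) * Real.tan (b * x))
        - a * b * x ^ 2 - (a * b ^ 3 + a ^ 3 * b) * x ^ 4 / 3| ≤ C * x ^ 6 := by
  obtain ⟨C, hC, h⟩ := (arctan_tan_mul_tan_isBigO a b).exists_pos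
  obtain ⟨δ, hδ, hball⟩ := Metric.nhds_basis_closedBall.eventually_iff.1 h.bound
  refine ⟨C, hC, δ, hδ, fun x hx => ?_⟩
  have := hball (show x ∈ Metric.closedBall 0 δ by simpa using hx)
  rwa [norm_of_nonneg (r := x ^ 6) (by positivity), norm_eq_abs] at this
end

section
/- There exist constants C > 0 and δ > 0 such that for all x with |x| ≤ δ, |arctan(tan²(arcsin|sin x|)) − arctan(tan²(arcsin(√(2/3) · sin² x))) − arctan(tan²(arcsin(√(22/45) · |sin x|³))) − x²| ≤ C · x⁸. That is, x² = GB(x) − GB(x, x, arcsin√(2/3)) − GB(x, x, x, arcsin√(22/45)) + O(x⁸). -/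
theorem tan_arcsin_sq_s15 {u : ℝ} (hu : u ^ 2 ≤ 1) :
    Real.tan (Real.arcsin u) ^ 2 = u ^ 2 / (1 - u ^ 2) := by
  rw [Real.tan_arcsin, div_pow, Real.sq_sqrt (by linarith)]

theorem sub_cube_div_three_le_arctan {t : ℝ} (ht : 0 ≤ t) : t - t ^ 3 / 3 ≤ Real.arctan t := by
  have hd (y : ℝ) : HasDerivAt (fun y => Real.arctan y - (y - y ^ 3 / 3))
      (1 / (1 + y ^ 2) - (1 - y ^ 2)) y := by
    refine ((Real.hasDerivAt_arctan y).sub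
      ((hasDerivAt_id y).sub (((hasDerivAt_id y).pow 3).div_const 3))).congr_deriv ?_
    norm_num
  have hm : Monotone (fun y => Real.arctan y - (y - y ^ 3 / 3)) := by
    refine monotone_of_hasDerivAt_nonneg hd fun y => ?_
    have : 1 / (1 + y ^ 2) - (1 - y ^ 2) = y ^ 4 / (1 + y ^ 2) := by field_simp; ring
    simp only [Pi.zero_apply, this]
    positivity
  simpa using hm ht

theorem arctan_le_sub_cube_add_pow_five {t : ℝ} (ht : 0 ≤ t) :
    Real.arctan t ≤ t - t ^ 3 / 3 + t ^ 5 / 5 := by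
  have hd (y : ℝ) : HasDerivAt (fun y => y - y ^ 3 / 3 + y ^ 5 / 5 - Real.arctan y)
      (1 - y ^ 2 + y ^ 4 - 1 / (1 + y ^ 2)) y := by
    refine ((((hasDerivAt_id y).sub (((hasDerivAt_id y).pow 3).div_const 3)).add
      (((hasDerivAt_id y).pow 5).div_const 5)).sub (Real.hasDerivAt_arctan y)).congr_deriv ?_
    norm_num
  have hm : Monotone (fun y => y - y ^ 3 / 3 + y ^ 5 / 5 - Real.arctan y) := by
    refine monotone_of_hasDerivAt_nonneg hd fun y => ?_
    have : 1 - y ^ 2 + y ^ 4 - 1 / (1 + y ^ 2) = y ^ 6 / (1 + y ^ 2) := by field_simp; ring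
    simp only [Pi.zero_apply, this]
    positivity
  simpa using hm ht

theorem abs_arctan_div_one_sub_sub_le {v : ℝ} (h0 : 0 ≤ v) (h1 : v ≤ 1 / 2) :
    |Real.arctan (v / (1 - v)) - (v + v ^ 2 + 2 / 3 * v ^ 3)| ≤ 10 * v ^ 4 := by
  obtain ⟨t, ht⟩ : ∃ t, t = v / (1 - v) := ⟨_, rfl⟩
  have ht0 : 0 ≤ t := ht ▸ div_nonneg h0 (by linarith)
  have hv : t = v + v * t := by rw [ht]; field_simp [show 1 - v ≠ 0 by linarith]; ring
  have ht2 : t ≤ 2 * v := by nlinarith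
  rw [← ht]
  have hl := sub_cube_div_three_le_arctan ht0
  have hu := arctan_le_sub_cube_add_pow_five ht0
  have e1 : t - v - v ^ 2 - v ^ 3 = v ^ 3 * t := by linear_combination (1 + v + v ^ 2) * hv
  have e2 : v ^ 3 * t ≤ 2 * v ^ 4 := by
    nlinarith [mul_le_mul_of_nonneg_left ht2 (pow_nonneg h0 3)]
  have e3 : t ^ 3 - v ^ 3 = v * t * (t ^ 2 + t * v + v ^ 2) := by
    linear_combination (t ^ 2 + t * v + v ^ 2) * hv
  have e4 : v * t * (t ^ 2 + t * v + v ^ 2) ≤ v * (2 * v) * ((2 * v) ^ 2 + 2 * v * v + v ^ 2) := by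
    gcongr
  have e5 : t ^ 5 ≤ (2 * v) ^ 5 := by gcongr
  have e6 : v ^ 5 ≤ v ^ 4 * (1 / 2) := by rw [pow_succ]; gcongr
  have e7 : 0 ≤ v ^ 3 * t := by positivity
  have e8 : 0 ≤ v * t * (t ^ 2 + t * v + v ^ 2) := by positivity
  have e9 : 0 ≤ v ^ 4 := by positivity
  rw [abs_le]
  constructor <;> nlinarith

theorem abs_arctan_div_one_sub_sub_self_le {v : ℝ} (h0 : 0 ≤ v) (h1 : v ≤ 1 / 2) :
    |Real.arctan (v / (1 - v)) - v| ≤ 5 * v ^ 2 := by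
  have h := abs_arctan_div_one_sub_sub_le h0 h1
  have e3 : v ^ 3 ≤ v ^ 2 * (1 / 2) := by rw [pow_succ]; gcongr
  have e4 : v ^ 4 ≤ v ^ 3 * (1 / 2) := by rw [pow_succ]; gcongr
  have e0 : 0 ≤ v ^ 3 := by positivity
  rw [abs_le] at h ⊢
  constructor <;> linarith [h.1, h.2]

theorem abs_cos_sub_taylor_le {x : ℝ} (hx : |x| ≤ 1) :
    |Real.cos x - (1 - x ^ 2 / 2 + x ^ 4 / 24 - x ^ 6 / 720)| ≤ x ^ 8 := by
  have h := Complex.exp_bound (x := x * Complex.I) (by simpa using hx) (n := 8) (by norm_num)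
  have hre := (Complex.abs_re_le_norm _).trans h
  have e : (Complex.exp (x * Complex.I) -
      ∑ m ∈ Finset.range 8, (x * Complex.I) ^ m / (m.factorial : ℂ)).re
      = Real.cos x - (1 - x ^ 2 / 2 + x ^ 4 / 24 - x ^ 6 / 720) := by
    have hs : ∑ m ∈ Finset.range 8, (x * Complex.I) ^ m / (m.factorial : ℂ) =
        ((1 - x ^ 2 / 2 + x ^ 4 / 24 - x ^ 6 / 720 : ℝ) : ℂ) +
          ((x - x ^ 3 / 6 + x ^ 5 / 120 - x ^ 7 / 5040 : ℝ) : ℂ) * Complex.I := by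
      have h2 := Complex.I_sq
      have h3 : Complex.I ^ 3 = -Complex.I := Complex.I_pow_three
      have h4 := Complex.I_pow_four
      have h5 : Complex.I ^ 5 = Complex.I := by rw [pow_succ, h4, one_mul]
      have h6 : Complex.I ^ 6 = -1 := by rw [pow_succ, h5, Complex.I_mul_I]
      have h7 : Complex.I ^ 7 = -Complex.I := by rw [pow_succ, h6, neg_one_mul]
      simp only [Finset.sum_range_succ, Finset.sum_range_zero, Nat.factorial, mul_pow,
        h2, h3, h4, h5, h6, h7]
      push_cast
      ring
    rw [hs, Complex.sub_re, Complex.exp_ofReal_mul_I_re, Complex.add_re, Complex.ofReal_re,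
      Complex.re_ofReal_mul, Complex.I_re, mul_zero, add_zero]
  rw [e] at hre
  refine hre.trans ?_
  have : ‖(x : ℂ) * Complex.I‖ ^ 8 = x ^ 8 := by
    simp [Even.pow_abs (show Even 8 by decide)]
  rw [this]
  have : 0 ≤ x ^ 8 := by positivity
  norm_num [Nat.factorial]
  linarith

theorem abs_sin_sq_sub_taylor_le {x : ℝ} (hx : |x| ≤ 1 / 2) :
    |Real.sin x ^ 2 - (x ^ 2 - x ^ 4 / 3 + 2 / 45 * x ^ 6)| ≤ 128 * x ^ 8 := by
  have h := abs_cos_sub_taylor_le (x := 2 * x) (by rw [abs_mul, abs_two]; linarith)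
  rw [Real.sin_sq_eq_half_sub]
  rw [abs_le] at h ⊢
  constructor <;> nlinarith [h.1, h.2]

theorem abs_sin_sq_cubic_sub_sq_le {x : ℝ} (hx : |x| ≤ 1 / 2) :
    |Real.sin x ^ 2 + (Real.sin x ^ 2) ^ 2 / 3 + 8 / 45 * (Real.sin x ^ 2) ^ 3 - x ^ 2|
      ≤ 400 * x ^ 8 := by
  have h := abs_sin_sq_sub_taylor_le hx
  have hs1 := Real.sin_sq_le_one x
  have hs0 := sq_nonneg (Real.sin x)
  have hy : x ^ 2 ≤ 1 / 4 := by
    have := sq_le_sq' (by linarith [abs_nonneg x]) hx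
    rw [sq_abs] at this; linarith
  have hy0 := sq_nonneg x
  obtain ⟨y, hxy⟩ : ∃ y, y = x ^ 2 := ⟨_, rfl⟩
  generalize Real.sin x ^ 2 = s at *
  rw [show x ^ 4 = y ^ 2 by rw [hxy]; ring, show x ^ 6 = y ^ 3 by rw [hxy]; ring,
    show x ^ 8 = y ^ 4 by rw [hxy]; ring] at *
  rw [← hxy] at h hy hy0 ⊢
  obtain ⟨p, hp⟩ : ∃ p, p = y - y ^ 2 / 3 + 2 / 45 * y ^ 3 := ⟨_, rfl⟩
  have hp0 : 0 ≤ p := by rw [hp]; nlinarith [pow_nonneg hy0 3]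
  have hp1 : p ≤ 1 := by rw [hp]; nlinarith [mul_nonneg hy0 hy0]
  rw [← hp] at h
  have hL : |s + s ^ 2 / 3 + 8 / 45 * s ^ 3 - (p + p ^ 2 / 3 + 8 / 45 * p ^ 3)| ≤ 3 * |s - p| := by
    rw [show s + s ^ 2 / 3 + 8 / 45 * s ^ 3 - (p + p ^ 2 / 3 + 8 / 45 * p ^ 3) =
      (1 + (s + p) / 3 + 8 / 45 * (s ^ 2 + s * p + p ^ 2)) * (s - p) by ring, abs_mul,
      abs_of_nonneg (by positivity)]
    gcongr
    nlinarith
  have hQ : |p + p ^ 2 / 3 + 8 / 45 * p ^ 3 - y| ≤ y ^ 4 := by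
    have hy1 : y ≤ 1 := by linarith
    have q1 := pow_nonneg hy0 2
    have q2 := pow_nonneg hy0 3
    have q3 := pow_nonneg hy0 4
    have q4 := pow_nonneg hy0 5
    have r1 := pow_le_one₀ (n := 2) hy0 hy1
    have r2 := pow_le_one₀ (n := 3) hy0 hy1
    have r3 := pow_le_one₀ (n := 4) hy0 hy1
    have r4 := pow_le_one₀ (n := 5) hy0 hy1
    have hq : |-1 / 9 + 148 / 2025 * y - 44 / 2025 * y ^ 2 + 112 / 30375 * y ^ 3
        - 32 / 91125 * y ^ 4 + 64 / 4100625 * y ^ 5| ≤ 1 := by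
      rw [abs_le]
      constructor <;> linarith
    rw [show p + p ^ 2 / 3 + 8 / 45 * p ^ 3 - y = (-1 / 9 + 148 / 2025 * y - 44 / 2025 * y ^ 2
        + 112 / 30375 * y ^ 3 - 32 / 91125 * y ^ 4 + 64 / 4100625 * y ^ 5) * y ^ 4 by rw [hp]; ring,
      abs_mul, abs_of_nonneg q3]
    exact mul_le_of_le_one_left q3 hq
  calc _ = |(s + s ^ 2 / 3 + 8 / 45 * s ^ 3 - (p + p ^ 2 / 3 + 8 / 45 * p ^ 3)) +
        (p + p ^ 2 / 3 + 8 / 45 * p ^ 3 - y)| := by congr 1; ring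
    _ ≤ _ := abs_add_le _ _
    _ ≤ _ := by linarith [pow_nonneg hy0 4]

/-- Eighth-order squaring formula from gearbox circuits:
`x² = GB(x) − GB(x, x, arcsin √(2/3)) − GB(x, x, x, arcsin √(22/45)) + O(x⁸)`. -/
theorem gearbox_squaring_eighth_order :
    ∃ C > (0:ℝ), ∃ δ > (0:ℝ), ∀ x : ℝ, |x| ≤ δ →
      |Real.arctan (Real.tan (Real.arcsin |Real.sin x|) ^ 2)
        - Real.arctan (Real.tan (Real.arcsin (Real.sqrt (2 / 3) * Real.sin x ^ 2)) ^ 2)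
        - Real.arctan (Real.tan (Real.arcsin (Real.sqrt (22 / 45) * |Real.sin x| ^ 3)) ^ 2)
        - x ^ 2| ≤ C * x ^ 8 := by
  refine ⟨1000, by norm_num, 1 / 2, by norm_num, fun x hx => ?_⟩
  have hP := abs_sin_sq_cubic_sub_sq_le hx
  have hsx : Real.sin x ^ 2 ≤ x ^ 2 := sq_le_sq.2 Real.abs_sin_le_abs
  have hy : x ^ 2 ≤ 1 / 4 := by
    have := sq_le_sq' (by linarith [abs_nonneg x]) hx
    rw [sq_abs] at this; linarith
  have hs0 := sq_nonneg (Real.sin x)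
  have e1 : |Real.sin x| ^ 2 = Real.sin x ^ 2 := sq_abs _
  have e2 : (Real.sqrt (2 / 3) * Real.sin x ^ 2) ^ 2 = 2 / 3 * (Real.sin x ^ 2) ^ 2 := by
    rw [mul_pow, Real.sq_sqrt (by norm_num)]
  have e3 : (Real.sqrt (22 / 45) * |Real.sin x| ^ 3) ^ 2 = 22 / 45 * (Real.sin x ^ 2) ^ 3 := by
    rw [mul_pow, Real.sq_sqrt (by norm_num), ← e1]; ring
  have hs4 : (Real.sin x ^ 2) ^ 4 ≤ x ^ 8 := by
    calc _ ≤ (x ^ 2) ^ 4 := by gcongr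
      _ = _ := by ring
  generalize Real.sin x ^ 2 = s at *
  have hs : s ≤ 1 / 4 := hsx.trans hy
  have b2 : s ^ 2 ≤ (1 / 4) ^ 2 := by gcongr
  have b3 : s ^ 3 ≤ (1 / 4) ^ 3 := by gcongr
  have b6 : s ^ 6 ≤ s ^ 4 := pow_le_pow_of_le_one hs0 (by linarith) (by norm_num)
  rw [tan_arcsin_sq_s15 (by linarith), tan_arcsin_sq_s15 (by linarith), tan_arcsin_sq_s15 (by linarith),
    e1, e2, e3]
  have h1 := abs_arctan_div_one_sub_sub_le hs0 (by linarith)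
  have h2 := abs_arctan_div_one_sub_sub_self_le (v := 2 / 3 * s ^ 2) (by positivity) (by linarith)
  have h3 := abs_arctan_div_one_sub_sub_self_le (v := 22 / 45 * s ^ 3) (by positivity) (by linarith)
  have c2 : (2 / 3 * s ^ 2) ^ 2 = 4 / 9 * s ^ 4 := by ring
  have c3 : (22 / 45 * s ^ 3) ^ 2 = 484 / 2025 * s ^ 6 := by ring
  rw [c2] at h2
  rw [c3] at h3
  rw [abs_le] at *
  constructor <;> linarith [h1.1, h1.2, h2.1, h2.2, h3.1, h3.2, hP.1, hP.2]
end

section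
/- Let H₁ = ℂ² and let H₂ be a finite-dimensional complex Hilbert space. Let U be a unitary on H₁ ⊗ H₂, let V be a unitary on H₂, and let θ ∈ (0, π/2). Suppose that for every unit vector ψ ∈ H₂ there exists a vector φ_ψ ∈ H₂ such that U(|0⟩ ⊗ ψ) = sin θ · |0⟩ ⊗ Vψ + cos θ · |1⟩ ⊗ φ_ψ. Define R := (|0⟩⟨0| − |1⟩⟨1|) ⊗ I and S := −U R U† R. Then for every natural number t and every unit vector ψ ∈ H₂, S^t U(|0⟩ ⊗ ψ) = sin((2t+1)θ) · |0⟩ ⊗ Vψ + cos((2t+1)θ) · |1⟩ ⊗ φ_ψ. (Oblivious amplitude amplification, Lemma 3 of the paper, due to Berry, Childs, Cleve et al.) -/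
open Real

/-- If a linear map agrees with a given linear map on the unit sphere, they agree everywhere. -/
lemma LinearMap.eq_of_eqOn_unit_sphere {E F : Type*} [NormedAddCommGroup E] [NormedSpace ℂ E]
    [AddCommGroup F] [Module ℂ F] {f g : E →ₗ[ℂ] F} (h : ∀ x, ‖x‖ = 1 → f x = g x) : f = g := by
  ext x
  rcases eq_or_ne x 0 with rfl | hx
  · simp
  · have hn : (‖x‖ : ℂ) ≠ 0 := by exact_mod_cast norm_ne_zero_iff.mpr hx
    have key := h ((‖x‖ : ℂ)⁻¹ • x) (by
      rw [norm_smul, norm_inv, Complex.norm_real, norm_norm,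
        inv_mul_cancel₀ (norm_ne_zero_iff.mpr hx)])
    rw [map_smul, map_smul] at key
    exact smul_right_injective F (inv_ne_zero hn) key

/-- If the upper left block of a unitary `U` on `H × H` is `c • V` with `c` real and `V` unitary,
then the upper left block of the adjoint of `U` is `c • V.symm`. -/
lemma fst_symm_toLp_of_fst_toLp {H : Type*} [NormedAddCommGroup H] [InnerProductSpace ℂ H]
    (U : WithLp 2 (H × H) ≃ₗᵢ[ℂ] WithLp 2 (H × H)) (V : H ≃ₗᵢ[ℂ] H) (c : ℝ)
    (hU : ∀ x, (U (WithLp.toLp 2 (x, 0))).fst = (c : ℂ) • V x) (x : H) :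
    (U.symm (WithLp.toLp 2 (V x, 0))).fst = (c : ℂ) • x := by
  refine ext_inner_left ℂ fun y => ?_
  have h := U.inner_map_map (WithLp.toLp 2 (y, 0)) (U.symm (WithLp.toLp 2 (V x, 0)))
  rw [U.apply_symm_apply] at h
  simpa [-Complex.coe_smul, hU, inner_smul_left, inner_smul_right] using h.symm

/-- Powers of a linear map acting as the rotation by `2θ` on a pair of vectors `a`, `b`. -/
lemma Module.End.pow_apply_of_rotation {M : Type*} [AddCommGroup M] [Module ℂ M]
    (S : Module.End ℂ M) (a b : M) (θ : ℝ)
    (ha : S a = (Real.cos (2 * θ) : ℂ) • a - (Real.sin (2 * θ) : ℂ) • b)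
    (hb : S b = (Real.sin (2 * θ) : ℂ) • a + (Real.cos (2 * θ) : ℂ) • b) (t : ℕ) :
    (S ^ t) ((Real.sin θ : ℂ) • a + (Real.cos θ : ℂ) • b) =
      (Real.sin ((2 * (t : ℝ) + 1) * θ) : ℂ) • a +
      (Real.cos ((2 * (t : ℝ) + 1) * θ) : ℂ) • b := by
  induction t with
  | zero => simp
  | succ t ih =>
    have hθ : (2 * ((t + 1 : ℕ) : ℝ) + 1) * θ = (2 * (t : ℝ) + 1) * θ + 2 * θ := by
      push_cast; ring
    rw [pow_succ', Module.End.mul_apply, ih, map_add, map_smul, map_smul, ha, hb, hθ,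
      Real.sin_add, Real.cos_add]
    push_cast
    module

/-- Oblivious amplitude amplification (Lemma 3 of the paper, due to Berry, Childs, Cleve
et al.): modelling `ℂ² ⊗ H₂` as the Hilbert-space direct sum `WithLp 2 (H₂ × H₂)`
(so `|0⟩ ⊗ ψ = (ψ, 0)` and `|1⟩ ⊗ φ = (0, φ)`), if the unitary `U` satisfies
`U(|0⟩ ⊗ ψ) = sin θ · |0⟩ ⊗ Vψ + cos θ · |1⟩ ⊗ φ_ψ` for every unit vector `ψ`, then
with `R = (|0⟩⟨0| − |1⟩⟨1|) ⊗ I` and `S = −U R U† R` one has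
`S^t U(|0⟩ ⊗ ψ) = sin((2t+1)θ) · |0⟩ ⊗ Vψ + cos((2t+1)θ) · |1⟩ ⊗ φ_ψ`. -/
theorem oblivious_amplitude_amplification
    (H2 : Type*) [NormedAddCommGroup H2] [InnerProductSpace ℂ H2] [FiniteDimensional ℂ H2]
    (U : WithLp 2 (H2 × H2) ≃ₗᵢ[ℂ] WithLp 2 (H2 × H2)) (V : H2 ≃ₗᵢ[ℂ] H2)
    (θ : ℝ) (hθ : θ ∈ Set.Ioo 0 (π / 2)) (φ : H2 → H2)
    (hU : ∀ ψ : H2, ‖ψ‖ = 1 →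
      U ((WithLp.linearEquiv 2 ℂ (H2 × H2)).symm (ψ, 0)) =
        (Real.sin θ : ℂ) • (WithLp.linearEquiv 2 ℂ (H2 × H2)).symm (V ψ, 0) +
        (Real.cos θ : ℂ) • (WithLp.linearEquiv 2 ℂ (H2 × H2)).symm (0, φ ψ))
    (t : ℕ) (ψ : H2) (hψ : ‖ψ‖ = 1) :
    let e := WithLp.linearEquiv 2 ℂ (H2 × H2)
    -- `R = (|0⟩⟨0| − |1⟩⟨1|) ⊗ I`, i.e. `(x, y) ↦ (x, −y)`
    let R : WithLp 2 (H2 × H2) →ₗ[ℂ] WithLp 2 (H2 × H2) :=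
      e.symm.toLinearMap ∘ₗ
        (LinearMap.prod (LinearMap.fst ℂ H2 H2) (-(LinearMap.snd ℂ H2 H2))) ∘ₗ e.toLinearMap
    -- `S = −U R U† R` (for the unitary `U`, the adjoint `U†` is `U.symm`)
    let S : Module.End ℂ (WithLp 2 (H2 × H2)) :=
      -(U.toLinearEquiv.toLinearMap ∘ₗ R ∘ₗ U.symm.toLinearEquiv.toLinearMap ∘ₗ R)
    (S ^ t) (U (e.symm (ψ, 0))) =
      (Real.sin ((2 * (t : ℝ) + 1) * θ) : ℂ) • e.symm (V ψ, 0) +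
      (Real.cos ((2 * (t : ℝ) + 1) * θ) : ℂ) • e.symm (0, φ ψ) := by
  intro e R S
  have hc : (Real.cos θ : ℂ) ≠ 0 := by
    exact_mod_cast (Real.cos_pos_of_mem_Ioo ⟨by linarith [hθ.1, Real.pi_pos], hθ.2⟩).ne'
  have hsc : (Real.sin θ : ℂ) ^ 2 + (Real.cos θ : ℂ) ^ 2 = 1 := by
    exact_mod_cast Real.sin_sq_add_cos_sq θ
  have hblock (x : H2) : (U (WithLp.toLp 2 (x, 0))).fst = (Real.sin θ : ℂ) • V x := by
    let f : H2 →ₗ[ℂ] H2 := LinearMap.fst ℂ H2 H2 ∘ₗ e.toLinearMap ∘ₗ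
      U.toLinearEquiv.toLinearMap ∘ₗ e.symm.toLinearMap ∘ₗ LinearMap.inl ℂ H2 H2
    have hf : f = (Real.sin θ : ℂ) • V.toLinearEquiv.toLinearMap := by
      refine LinearMap.eq_of_eqOn_unit_sphere fun y hy => ?_
      change (U (e.symm (y, 0))).fst = (Real.sin θ : ℂ) • V y
      rw [hU y hy]
      simp
    exact LinearMap.congr_fun hf x
  set z := e.symm (ψ, 0)
  set a := e.symm (V ψ, 0)
  set b := e.symm (0, φ ψ)
  have hUz : U z = (Real.sin θ : ℂ) • a + (Real.cos θ : ℂ) • b := hU ψ hψ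
  have hRz : R z = z := by simp [R, z]
  have hRa : R a = a := by simp [R, a]
  have hRb : R b = -b := by
    apply e.injective
    simp [R, b]
  have hfst : (U.symm a).fst = (Real.sin θ : ℂ) • ψ := fst_symm_toLp_of_fst_toLp U V _ hblock ψ
  have hRUa : R (U.symm a) = (2 * Real.sin θ : ℂ) • z - U.symm a := by
    apply e.injective
    refine Prod.ext ?_ ?_
    · change (U.symm a).fst = (2 * Real.sin θ : ℂ) • ψ - (U.symm a).fst
      rw [hfst]
      module
    · change -(U.symm a).snd = (2 * Real.sin θ : ℂ) • (0 : H2) - (U.symm a).snd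
      simp
  have hS (x) : S x = -U (R (U.symm (R x))) := rfl
  have hSa : S a = a - (2 * Real.sin θ : ℂ) • U z := by
    rw [hS, hRa, hRUa, map_sub, map_smul, U.apply_symm_apply]
    module
  have hb : b = (Real.cos θ : ℂ)⁻¹ • (U z - (Real.sin θ : ℂ) • a) := by
    rw [hUz, add_sub_cancel_left, inv_smul_smul₀ hc]
  have hSb : S b = (Real.cos θ : ℂ)⁻¹ •
      ((1 - 2 * (Real.sin θ : ℂ) ^ 2) • U z + (Real.sin θ : ℂ) • a) := by
    have hUb : U.symm b = (Real.cos θ : ℂ)⁻¹ • (z - (Real.sin θ : ℂ) • U.symm a) := by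
      conv_lhs => rw [hb]
      rw [map_smul, map_sub, map_smul, U.symm_apply_apply]
    rw [hS, hRb, map_neg, map_neg, map_neg, neg_neg, hUb, map_smul, map_sub, map_smul R, hRz, hRUa]
    simp only [map_smul, map_sub, U.apply_symm_apply]
    module
  rw [hUz]
  refine Module.End.pow_apply_of_rotation S a b θ ?_ ?_ t
  · rw [hSa, hUz, Real.cos_two_mul, Real.sin_two_mul]
    push_cast at hsc ⊢
    match_scalars
    · linear_combination (-2) * hsc
    · ring
  · rw [hSb, hUz, Real.cos_two_mul, Real.sin_two_mul]
    push_cast at hc hsc ⊢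
    match_scalars
    · field_simp
      linear_combination (-2 * Complex.sin θ) * hsc
    · field_simp
      linear_combination (-2) * hsc
end

section
/- Let H = ℂ² and let K be a finite-dimensional complex Hilbert space. Let U be a unitary on H ⊗ K and V a unitary on K such that for every unit vector ψ ∈ K there exists φ_ψ ∈ K with U(|0⟩ ⊗ ψ) = (|0⟩ ⊗ Vψ + |1⟩ ⊗ φ_ψ)/√2. Let Hd be the Hadamard gate on ℂ² and define Ũ := Hd ⊗ U, a unitary on ℂ² ⊗ H ⊗ K. Let P := |0⟩⟨0| ⊗ |0⟩⟨0| ⊗ I be the projector onto the first two qubits being |00⟩, and let R := 2P − I. Then for every unit vector ψ ∈ K, −Ũ R Ũ† R Ũ (|0⟩ ⊗ |0⟩ ⊗ ψ) = |0⟩ ⊗ |0⟩ ⊗ Vψ. (Corollary 3: a non-deterministic circuit with success probability 1/2 can be made deterministic using three applications of U and a constant-sized Clifford circuit.) -/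
open Real

/-- If `U (v, 0) = (V v, φ v) / √2` for all unit vectors `v`, then the block `⟨0|U†|0⟩` of the
adjoint is `V† / √2`. -/
lemma fst_symm_apply_of_half_success
    {K : Type*} [NormedAddCommGroup K] [InnerProductSpace ℂ K]
    (U : WithLp 2 (K × K) ≃ₗᵢ[ℂ] WithLp 2 (K × K)) (V : K ≃ₗᵢ[ℂ] K) (φ : K → K)
    (hU : ∀ ψ : K, ‖ψ‖ = 1 →
      U (WithLp.toLp 2 (ψ, 0)) =
        (Real.sqrt 2 : ℂ)⁻¹ • (WithLp.toLp 2 (V ψ, 0) + WithLp.toLp 2 (0, φ ψ)))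
    (ψ : K) :
    (U.symm (WithLp.toLp 2 (V ψ, 0))).fst = (Real.sqrt 2 : ℂ)⁻¹ • ψ := by
  have inner_unit (v : K) (hv : ‖v‖ = 1) :
      inner ℂ v (U.symm (WithLp.toLp 2 (V ψ, 0))).fst
        = inner ℂ v ((Real.sqrt 2 : ℂ)⁻¹ • ψ) := by
    have h := U.inner_map_map (WithLp.toLp 2 (v, 0)) (U.symm (WithLp.toLp 2 (V ψ, 0)))
    rw [U.apply_symm_apply, hU v hv] at h
    simpa [WithLp.prod_inner_apply, inner_smul_left, inner_smul_right, inner_add_left]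
      using h.symm
  refine ext_inner_left ℂ fun v => ?_
  rcases eq_or_ne v 0 with rfl | hv
  · simp
  · have h := inner_unit ((‖v‖ : ℂ)⁻¹ • v) (by simp [norm_smul, hv])
    rw [inner_smul_left, inner_smul_left] at h
    exact mul_left_cancel₀ (by simpa using hv) h

/-- Corollary 3 of the paper: a non-deterministic circuit with success probability `1/2`
can be made deterministic using three applications of `U` and a constant-sized Clifford
circuit.  Here `H ⊗ K` (with `H = ℂ²`) is modelled as the Hilbert-space direct sum
`KK := WithLp 2 (K × K)` (so `|0⟩ ⊗ ψ = (ψ, 0)`, `|1⟩ ⊗ φ = (0, φ)`), and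
`ℂ² ⊗ H ⊗ K` as `KK × KK`.  If `U(|0⟩ ⊗ ψ) = (|0⟩ ⊗ Vψ + |1⟩ ⊗ φ_ψ)/√2` for every unit
vector `ψ`, then with `Ũ = Hd ⊗ U`, `P = |0⟩⟨0| ⊗ |0⟩⟨0| ⊗ I` and `R = 2P − I` one has
`−Ũ R Ũ† R Ũ (|0⟩ ⊗ |0⟩ ⊗ ψ) = |0⟩ ⊗ |0⟩ ⊗ Vψ`. -/
theorem deterministic_from_half_success_probability
    (K : Type*) [NormedAddCommGroup K] [InnerProductSpace ℂ K] [FiniteDimensional ℂ K]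
    (U : WithLp 2 (K × K) ≃ₗᵢ[ℂ] WithLp 2 (K × K)) (V : K ≃ₗᵢ[ℂ] K) (φ : K → K)
    (hU : ∀ ψ : K, ‖ψ‖ = 1 →
      U ((WithLp.linearEquiv 2 ℂ (K × K)).symm (ψ, 0)) =
        ((Real.sqrt 2 : ℂ))⁻¹ • ((WithLp.linearEquiv 2 ℂ (K × K)).symm (V ψ, 0)
          + (WithLp.linearEquiv 2 ℂ (K × K)).symm (0, φ ψ)))
    (ψ : K) (hψ : ‖ψ‖ = 1) :
    let KK := WithLp 2 (K × K)
    let e := WithLp.linearEquiv 2 ℂ (K × K)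
    let Ul : KK →ₗ[ℂ] KK := U.toLinearEquiv.toLinearMap
    -- for the unitary `U`, the adjoint `U†` is `U.symm`
    let Udag : KK →ₗ[ℂ] KK := U.symm.toLinearEquiv.toLinearMap
    let c : ℂ := (Real.sqrt 2 : ℂ)⁻¹
    let fst := LinearMap.fst ℂ KK KK
    let snd := LinearMap.snd ℂ KK KK
    -- `Ũ = Hd ⊗ U`, where `Hd` is the Hadamard gate on the new ancilla qubit
    let tU : (KK × KK) →ₗ[ℂ] (KK × KK) :=
      LinearMap.prod (c • (Ul ∘ₗ fst + Ul ∘ₗ snd)) (c • (Ul ∘ₗ fst - Ul ∘ₗ snd))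
    -- `Ũ† = Hd ⊗ U†`
    let tUdag : (KK × KK) →ₗ[ℂ] (KK × KK) :=
      LinearMap.prod (c • (Udag ∘ₗ fst + Udag ∘ₗ snd)) (c • (Udag ∘ₗ fst - Udag ∘ₗ snd))
    -- the projector `|0⟩⟨0| ⊗ I` on `KK = ℂ² ⊗ K`
    let pr0 : KK →ₗ[ℂ] KK :=
      e.symm.toLinearMap ∘ₗ (LinearMap.prod (LinearMap.fst ℂ K K) 0) ∘ₗ e.toLinearMap
    -- `P = |0⟩⟨0| ⊗ |0⟩⟨0| ⊗ I`, the projector onto the first two qubits being `|00⟩`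
    let P : (KK × KK) →ₗ[ℂ] (KK × KK) := LinearMap.prod (pr0 ∘ₗ fst) 0
    let R : (KK × KK) →ₗ[ℂ] (KK × KK) := (2 : ℂ) • P - LinearMap.id;
    -(tU (R (tUdag (R (tU ((e.symm (ψ, 0) : KK), (0 : KK))))))) =
      ((e.symm (V ψ, 0) : KK), (0 : KK)) := by
  have hU' (v : K) (hv : ‖v‖ = 1) : U (WithLp.toLp 2 (v, 0)) =
      (Real.sqrt 2 : ℂ)⁻¹ • (WithLp.toLp 2 (V v, 0) + WithLp.toLp 2 (0, φ v)) := hU v hv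
  have hw := fst_symm_apply_of_half_success U V φ hU' ψ
  intro KK e Ul Udag c fst snd tU tUdag pr0 P R
  have hc : c * c = 1 / 2 := by
    have h : (Real.sqrt 2 : ℂ) * (Real.sqrt 2 : ℂ) = 2 := by
      exact_mod_cast Real.mul_self_sqrt (by norm_num : (0 : ℝ) ≤ 2)
    simp only [c, ← mul_inv, h, one_div]
  set x : KK := e.symm (ψ, 0)
  set y : KK := e.symm (V ψ, 0)
  set z : KK := e.symm (0, φ ψ)
  have hUx : Ul x = c • (y + z) := hU ψ hψ
  have hpx : pr0 x = x := rfl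
  have hpy : pr0 y = y := rfl
  have hpz : pr0 z = 0 := rfl
  have hpw : pr0 (Udag y) = c • x := by
    change e.symm ((U.symm (WithLp.toLp 2 (V ψ, 0))).fst, 0) = c • e.symm (ψ, 0)
    rw [hw, ← map_smul, Prod.smul_mk, smul_zero]
  have hUw : Ul (Udag y) = y := U.apply_symm_apply y
  have hx : c • (Udag y + Udag z) = x := by
    rw [← map_add, ← map_smul, ← hUx]
    exact U.symm_apply_apply x
  have tU_apply (a b : KK) : tU (a, b) = (c • (Ul a + Ul b), c • (Ul a - Ul b)) := rfl
  have tUdag_apply (a b : KK) :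
      tUdag (a, b) = (c • (Udag a + Udag b), c • (Udag a - Udag b)) := rfl
  have R_apply (a b : KK) : R (a, b) = ((2 : ℂ) • pr0 a - a, -b) := by
    change ((2 : ℂ) • pr0 a - a, (2 : ℂ) • (0 : KK) - b) = _
    rw [smul_zero, zero_sub]
  have hRU : R (tU (x, 0)) =
      ((1 / 2 : ℂ) • (y - z), -((1 / 2 : ℂ) • (y + z))) := by
    rw [tU_apply, map_zero, add_zero, sub_zero, hUx, smul_smul, hc, R_apply, map_smul,
      map_add, hpy, hpz]
    congr 1
    module
  have hURU : tUdag (R (tU (x, 0))) = (c • Udag y - x, c • Udag y) := by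
    rw [hRU, tUdag_apply, ← hx]
    simp only [map_neg, map_smul, map_add, map_sub]
    congr 1 <;> module
  have hRURU : R (tUdag (R (tU (x, 0)))) = (-(c • Udag y), -(c • Udag y)) := by
    rw [hURU, R_apply, map_sub, map_smul, hpw, hpx, smul_smul, hc]
    congr 1
    module
  rw [hRURU, tU_apply, map_neg, map_smul, hUw, sub_self, smul_zero, Prod.neg_mk, neg_zero,
    ← neg_add, smul_neg, neg_neg, ← two_smul ℂ, smul_smul, smul_smul]
  congr 1
  rw [show c * 2 * c = 1 by linear_combination 2 * hc, one_smul]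
end
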